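/- arXiv:math/0612734 — 9 statements merged into one kernel-verified Lean document; each statement's English description precedes it below -/
import Mathlib

section
/- Let G' be the subgroup of GL(2, ℤ/9ℤ) generated by S̃ = [[0,2],[4,0]], T̃ = [[4,1],[-3,4]], the matrix D = [[-1,0],[0,1]], and all scalar matrices u·I with u a unit of ℤ/9ℤ. Then: (a) the determinant homomorphism maps G' onto the full unit group (ℤ/9ℤ)ˣ; and (b) an element M of G' has determinant 1 if and only if M lies in the subgroup G of SL(2, ℤ/9ℤ) generated by S̃ and T̃ (viewed inside GL(2, ℤ/9ℤ)). -/
open Matrix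

/-- S̃ = [[0,2],[4,0]] as an element of SL(2, ℤ/9ℤ). -/
def Stil : SpecialLinearGroup (Fin 2) (ZMod 9) := ⟨!![0, 2; 4, 0], by decide⟩

/-- T̃ = [[4,1],[-3,4]] as an element of SL(2, ℤ/9ℤ). -/
def Ttil : SpecialLinearGroup (Fin 2) (ZMod 9) := ⟨!![4, 1; -3, 4], by decide⟩

/-- G, the subgroup of SL(2, ℤ/9ℤ) generated by S̃ and T̃. -/
def G : Subgroup (SpecialLinearGroup (Fin 2) (ZMod 9)) := Subgroup.closure {Stil, Ttil}

/-- G', the subgroup of GL(2, ℤ/9ℤ) generated by S̃, T̃, D = [[-1,0],[0,1]] and all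
scalar matrices u·I with u ∈ (ℤ/9ℤ)ˣ. -/
def G' : Subgroup (GL (Fin 2) (ZMod 9)) :=
  Subgroup.closure {M | (M : Matrix (Fin 2) (Fin 2) (ZMod 9)) = !![0, 2; 4, 0] ∨
    (M : Matrix (Fin 2) (Fin 2) (ZMod 9)) = !![4, 1; -3, 4] ∨
    (M : Matrix (Fin 2) (Fin 2) (ZMod 9)) = !![-1, 0; 0, 1] ∨
    ∃ u : (ZMod 9)ˣ, (M : Matrix (Fin 2) (Fin 2) (ZMod 9)) =
      (u : ZMod 9) • (1 : Matrix (Fin 2) (Fin 2) (ZMod 9))}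

open Matrix.SpecialLinearGroup (toGL)

/-- The reflection `diag(-1, 1)` as an element of `GL(2, ℤ/9ℤ)`. -/
def reflection : GL (Fin 2) (ZMod 9) :=
  ⟨!![-1, 0; 0, 1], !![-1, 0; 0, 1], by decide, by decide⟩

lemma reflection_mul_self : reflection * reflection = 1 := by
  ext : 1; decide

lemma neg_one_mem_G : (-1 : SpecialLinearGroup (Fin 2) (ZMod 9)) ∈ G := by
  have h : Stil * Stil = -1 := by decide
  have hS : Stil ∈ G := Subgroup.subset_closure (by simp)
  exact h ▸ mul_mem hS hS

/-- The reflection normalizes `G`: it maps `S̃` to `-S̃` and `T̃` to `T̃⁻¹`. -/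
lemma exists_reflection_mul_eq {N : SpecialLinearGroup (Fin 2) (ZMod 9)} (hN : N ∈ G) :
    ∃ N' ∈ G, reflection * toGL N = toGL N' * reflection := by
  induction hN using Subgroup.closure_induction with
  | mem x hx =>
    have hS : Stil ∈ G := Subgroup.subset_closure (by simp)
    have hT : Ttil ∈ G := Subgroup.subset_closure (by simp)
    rcases hx with rfl | rfl
    · refine ⟨-1 * Stil, mul_mem neg_one_mem_G hS, ?_⟩
      ext : 1; decide
    · refine ⟨Ttil⁻¹, inv_mem hT, ?_⟩
      ext : 1; decide
  | one => exact ⟨1, one_mem _, by simp⟩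
  | mul x y _ _ hx hy =>
    obtain ⟨x', hx', ex⟩ := hx
    obtain ⟨y', hy', ey⟩ := hy
    exact ⟨x' * y', mul_mem hx' hy', by
      rw [map_mul, map_mul, ← mul_assoc, ex, mul_assoc, ey, mul_assoc]⟩
  | inv x _ hx =>
    obtain ⟨x', hx', ex⟩ := hx
    refine ⟨x'⁻¹, inv_mem hx', ?_⟩
    rw [map_inv, map_inv, eq_inv_mul_iff_mul_eq, ← mul_assoc, ← ex, mul_inv_cancel_right]

/-- Every element of `G'` is a scalar times an element of `G`, possibly times the reflection. -/
lemma exists_scalar_mul_of_mem {M : GL (Fin 2) (ZMod 9)} (hM : M ∈ G') :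
    ∃ u : (ZMod 9)ˣ, ∃ N ∈ G,
      M = GeneralLinearGroup.scalar (Fin 2) u * toGL N ∨
      M = GeneralLinearGroup.scalar (Fin 2) u * (toGL N * reflection) := by
  have move (u v : (ZMod 9)ˣ) (A B : GL (Fin 2) (ZMod 9)) :
      GeneralLinearGroup.scalar (Fin 2) u * A * (GeneralLinearGroup.scalar (Fin 2) v * B) =
        GeneralLinearGroup.scalar (Fin 2) (u * v) * (A * B) := by
    rw [map_mul, mul_assoc, ← mul_assoc A, ← GeneralLinearGroup.scalar_commute v A]; simp only [mul_assoc]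
  have invert (u : (ZMod 9)ˣ) (A : GL (Fin 2) (ZMod 9)) :
      (GeneralLinearGroup.scalar (Fin 2) u * A)⁻¹ =
        GeneralLinearGroup.scalar (Fin 2) u⁻¹ * A⁻¹ := by
    rw [_root_.mul_inv_rev, ← map_inv, GeneralLinearGroup.scalar_commute]
  induction hM using Subgroup.closure_induction with
  | mem x hx =>
    rcases hx with hx | hx | hx | ⟨u, hx⟩
    · refine ⟨1, Stil, Subgroup.subset_closure (by simp), .inl ?_⟩
      rw [map_one, one_mul]; exact Units.ext hx
    · refine ⟨1, Ttil, Subgroup.subset_closure (by simp), .inl ?_⟩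
      rw [map_one, one_mul]; exact Units.ext hx
    · refine ⟨1, 1, one_mem _, .inr ?_⟩
      rw [map_one, map_one, one_mul, one_mul]; exact Units.ext hx
    · refine ⟨u, 1, one_mem _, .inl ?_⟩
      rw [map_one, mul_one]
      refine Units.ext (hx.trans ?_)
      simp [Matrix.smul_one_eq_diagonal]
  | one => exact ⟨1, 1, one_mem _, .inl (by simp)⟩
  | mul x y _ _ hx hy =>
    obtain ⟨u, A, hA, ex⟩ := hx
    obtain ⟨v, B, hB, ey⟩ := hy
    obtain ⟨B', hB', eB⟩ := exists_reflection_mul_eq hB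
    rcases ex with rfl | rfl <;> rcases ey with rfl | rfl <;> rw [move]
    · exact ⟨u * v, A * B, mul_mem hA hB, .inl (by rw [map_mul toGL])⟩
    · exact ⟨u * v, A * B, mul_mem hA hB, .inr (by rw [map_mul toGL, mul_assoc])⟩
    · exact ⟨u * v, A * B', mul_mem hA hB', .inr (by rw [mul_assoc, eB, map_mul toGL, mul_assoc])⟩
    · exact ⟨u * v, A * B', mul_mem hA hB', .inl (by
        rw [mul_assoc, ← mul_assoc reflection, eB, mul_assoc, reflection_mul_self, mul_one,
          map_mul toGL])⟩
  | inv x _ hx =>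
    obtain ⟨u, A, hA, ex⟩ := hx
    obtain ⟨B, hB, eB⟩ := exists_reflection_mul_eq (inv_mem hA)
    rcases ex with rfl | rfl <;> rw [invert]
    · exact ⟨u⁻¹, A⁻¹, inv_mem hA, .inl (by rw [map_inv toGL])⟩
    · exact ⟨u⁻¹, B, hB, .inr (by
        rw [_root_.mul_inv_rev, inv_eq_of_mul_eq_one_right reflection_mul_self, ← map_inv toGL, eB])⟩

lemma det_toGL_eq_one (N : SpecialLinearGroup (Fin 2) (ZMod 9)) :
    GeneralLinearGroup.det (toGL N) = 1 :=
  Units.ext N.det_coe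

lemma det_reflection : GeneralLinearGroup.det reflection = -1 := by
  ext : 1; decide

/-- (a) The determinant maps G' onto the full unit group (ℤ/9ℤ)ˣ; (b) an element of G'
has determinant 1 if and only if it lies in the subgroup G of SL(2, ℤ/9ℤ) generated by
S̃ and T̃ (viewed inside GL(2, ℤ/9ℤ)). -/
theorem Gprime_det_surjective_and_ker_eq_G :
    Subgroup.map (Matrix.GeneralLinearGroup.det) G' = ⊤ ∧
    ∀ M ∈ G', (Matrix.GeneralLinearGroup.det M = 1 ↔
      ∃ N ∈ G, ((N : SpecialLinearGroup (Fin 2) (ZMod 9)) : Matrix (Fin 2) (Fin 2) (ZMod 9)) =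
        (M : Matrix (Fin 2) (Fin 2) (ZMod 9))) := by
  refine ⟨?_, fun M hM => ⟨fun hdet => ?_, ?_⟩⟩
  · rw [eq_top_iff]
    rintro u -
    have hR : reflection ∈ G' := Subgroup.subset_closure (.inr (.inr (.inl rfl)))
    have hscalar (v : (ZMod 9)ˣ) : GeneralLinearGroup.scalar (Fin 2) v ∈ G' :=
      Subgroup.subset_closure (.inr (.inr (.inr ⟨v, by simp [Matrix.smul_one_eq_diagonal]⟩)))
    have hu : ∀ u : (ZMod 9)ˣ, ∃ v : (ZMod 9)ˣ, v ^ 2 = u ∨ v ^ 2 * -1 = u := by decide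
    obtain ⟨v, rfl | rfl⟩ := hu u
    · exact ⟨_, hscalar v, GeneralLinearGroup.det_scalar v⟩
    · exact ⟨_, mul_mem (hscalar v) hR, by rw [map_mul, GeneralLinearGroup.det_scalar, det_reflection,
        Fintype.card_fin]⟩
  · obtain ⟨u, N, hN, rfl | rfl⟩ := exists_scalar_mul_of_mem hM
    · rw [map_mul, GeneralLinearGroup.det_scalar, det_toGL_eq_one, mul_one] at hdet
      have hu : ∀ u : (ZMod 9)ˣ, u ^ 2 = 1 → u = 1 ∨ u = -1 := by decide
      obtain rfl | rfl := hu u hdet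
      · exact ⟨N, hN, by simp⟩
      · exact ⟨-1 * N, mul_mem neg_one_mem_G hN, by ext i j; simp [Matrix.diagonal_mul]⟩
    · rw [map_mul, map_mul, GeneralLinearGroup.det_scalar, det_toGL_eq_one, det_reflection, one_mul] at hdet
      have hu : ∀ u : (ZMod 9)ˣ, u ^ 2 * -1 ≠ 1 := by decide
      exact absurd hdet (hu u)
  · rintro ⟨N, -, hN⟩
    rw [← det_toGL_eq_one N]
    exact congrArg _ (Units.ext hN.symm)
end

section
/- There are no rational numbers x, z with z³ = 3·(2x³ + 3x² − 3x − 5). In particular, 3(2x³+3x²−3x−5) is never a cube of a rational number for x ∈ ℚ (its only possible cube value, 0, is also not attained since 2x³+3x²−3x−5 has no rational root). -/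
/-- Infinite descent at a prime `p`: every solution of `x³ + p y³ = p² z³` is divisible by every
power of `p`. -/
theorem pow_dvd_of_cube_add_mul_cube_eq {R : Type*} [CommRing R] [IsDomain R] {p : R}
    (hp : Prime p) (n : ℕ) {x y z : R} (h : x ^ 3 + p * y ^ 3 = p ^ 2 * z ^ 3) :
    p ^ n ∣ x ∧ p ^ n ∣ y ∧ p ^ n ∣ z := by
  induction n generalizing x y z with
  | zero => simp
  | succ n ih =>
    obtain ⟨x, rfl⟩ : p ∣ x :=
      hp.dvd_of_dvd_pow (n := 3) ⟨p * z ^ 3 - y ^ 3, by linear_combination h⟩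
    have h₁ : p ^ 2 * x ^ 3 + y ^ 3 = p * z ^ 3 :=
      mul_left_cancel₀ hp.ne_zero (by linear_combination h)
    obtain ⟨y, rfl⟩ : p ∣ y :=
      hp.dvd_of_dvd_pow (n := 3) ⟨z ^ 3 - p * x ^ 3, by linear_combination h₁⟩
    have h₂ : p * x ^ 3 + p ^ 2 * y ^ 3 = z ^ 3 :=
      mul_left_cancel₀ hp.ne_zero (by linear_combination h₁)
    obtain ⟨z, rfl⟩ : p ∣ z :=
      hp.dvd_of_dvd_pow (n := 3) ⟨x ^ 3 + p * y ^ 3, by linear_combination -h₂⟩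
    have h₃ : x ^ 3 + p * y ^ 3 = p ^ 2 * z ^ 3 :=
      mul_left_cancel₀ hp.ne_zero (by linear_combination h₂)
    obtain ⟨hx, hy, hz⟩ := ih h₃
    simp only [pow_succ']
    exact ⟨mul_dvd_mul_left p hx, mul_dvd_mul_left p hy, mul_dvd_mul_left p hz⟩

theorem eq_zero_of_cube_add_mul_cube_eq {R : Type*} [CommRing R] [IsDomain R] [WfDvdMonoid R]
    {p : R} (hp : Prime p) {x y z : R} (h : x ^ 3 + p * y ^ 3 = p ^ 2 * z ^ 3) :
    x = 0 ∧ y = 0 ∧ z = 0 := by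
  have eq_zero {a : R} (ha : ∀ n : ℕ, p ^ n ∣ a) : a = 0 := by
    by_contra h₀
    obtain ⟨n, hn⟩ := FiniteMultiplicity.of_prime_left hp h₀
    exact hn (ha (n + 1))
  exact ⟨eq_zero fun n ↦ (pow_dvd_of_cube_add_mul_cube_eq hp n h).1,
    eq_zero fun n ↦ (pow_dvd_of_cube_add_mul_cube_eq hp n h).2.1,
    eq_zero fun n ↦ (pow_dvd_of_cube_add_mul_cube_eq hp n h).2.2⟩


/-- There are no rational numbers x, z with z³ = 3(2x³ + 3x² - 3x - 5); in particular
2x³ + 3x² - 3x - 5 has no rational root, so 3(2x³+3x²-3x-5) is never the cube of a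
rational number. -/
theorem no_rational_cube :
    (¬ ∃ x z : ℚ, z ^ 3 = 3 * (2 * x ^ 3 + 3 * x ^ 2 - 3 * x - 5)) ∧
    ∀ x : ℚ, 2 * x ^ 3 + 3 * x ^ 2 - 3 * x - 5 ≠ 0 := by
  have key (x z : ℚ) : z ^ 3 ≠ 3 * (2 * x ^ 3 + 3 * x ^ 2 - 3 * x - 5) := by
    intro h
    have hx : (x.den : ℚ) ≠ 0 := by exact_mod_cast x.den_ne_zero
    have hz : (z.den : ℚ) ≠ 0 := by exact_mod_cast z.den_ne_zero
    have hint : (z.num * x.den) ^ 3 + 3 * ((x.num + 2 * x.den) * z.den) ^ 3 =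
        (3 : ℤ) ^ 2 * ((x.num + x.den) * z.den) ^ 3 := by
      rw [← Rat.num_div_den x, ← Rat.num_div_den z] at h
      field_simp at h
      have h' : ((z.num * x.den) ^ 3 + 3 * ((x.num + 2 * x.den) * z.den) ^ 3 : ℚ) =
          3 ^ 2 * ((x.num + x.den) * z.den) ^ 3 := by linear_combination h
      exact_mod_cast h'
    obtain ⟨-, hb, ha⟩ := eq_zero_of_cube_add_mul_cube_eq Int.prime_three hint
    have hden : (x.den * z.den : ℤ) = 0 := by linear_combination hb - ha
    exact mul_ne_zero hx hz (by exact_mod_cast hden)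
  refine ⟨fun ⟨x, z, h⟩ ↦ key x z h, fun x h ↦ key x 0 ?_⟩
  rw [h]
  norm_num
end

section
/- For every rational number x with 2x³ + 3x² − 3x − 5 ≠ 0, the 3-adic valuation of the rational number 3·(2x³ + 3x² − 3x − 5) is not divisible by 3. -/
/-- The two summands `9 * a ^ 3` and `3 * b ^ 3` have 3-adic valuations congruent to `2` and `1`
modulo `3`, so they cannot cancel into a sum whose valuation is divisible by `3`. -/
theorem not_three_dvd_padicValRat_nine_mul_cube_add_three_mul_cube (a b : ℚ)
    (h : 9 * a ^ 3 + 3 * b ^ 3 ≠ 0) :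
    ¬ (3 : ℤ) ∣ padicValRat 3 (9 * a ^ 3 + 3 * b ^ 3) := by
  have : Fact (Nat.Prime 3) := ⟨Nat.prime_three⟩
  have h3 : padicValRat 3 (3 : ℚ) = 1 := by
    exact_mod_cast padicValRat.self (p := 3) (by norm_num)
  have h9 : padicValRat 3 (9 : ℚ) = 2 := by
    rw [show (9 : ℚ) = 3 ^ 2 by norm_num, padicValRat.pow, h3]
    norm_num
  have ha (ha0 : a ≠ 0) : padicValRat 3 (9 * a ^ 3) = 2 + 3 * padicValRat 3 a := by
    rw [padicValRat.mul (by norm_num) (pow_ne_zero 3 ha0), padicValRat.pow, h9]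
    norm_num
  have hb (hb0 : b ≠ 0) : padicValRat 3 (3 * b ^ 3) = 1 + 3 * padicValRat 3 b := by
    rw [padicValRat.mul (by norm_num) (pow_ne_zero 3 hb0), padicValRat.pow, h3]
    norm_num
  rcases eq_or_ne a 0 with rfl | ha0
  · have hb0 : b ≠ 0 := by
      rintro rfl
      simp at h
    rw [show (9 : ℚ) * 0 ^ 3 + 3 * b ^ 3 = 3 * b ^ 3 by ring, hb hb0]
    omega
  rcases eq_or_ne b 0 with rfl | hb0
  · rw [show 9 * a ^ 3 + 3 * (0 : ℚ) ^ 3 = 9 * a ^ 3 by ring, ha ha0]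
    omega
  rw [padicValRat.add_eq_min h (by positivity) (by positivity)
    (by rw [ha ha0, hb hb0]; omega), ha ha0, hb hb0]
  omega

/-- For every rational x with 2x³ + 3x² - 3x - 5 ≠ 0, the 3-adic valuation of
3(2x³ + 3x² - 3x - 5) is not divisible by 3. -/
theorem padicVal_not_div_three (x : ℚ) (hx : 2 * x ^ 3 + 3 * x ^ 2 - 3 * x - 5 ≠ 0) :
    ¬ (3 : ℤ) ∣ padicValRat 3 (3 * (2 * x ^ 3 + 3 * x ^ 2 - 3 * x - 5)) := by
  have key : 3 * (2 * x ^ 3 + 3 * x ^ 2 - 3 * x - 5) =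
      9 * (x + 1) ^ 3 + 3 * (-(x + 2)) ^ 3 := by
    ring
  rw [key]
  apply not_three_dvd_padicValRat_nine_mul_cube_add_three_mul_cube
  rw [← key]
  exact mul_ne_zero (by norm_num) hx
end

section
/- Let f : ℚ → ℚ be given by f(x) = 3⁷(x²−1)³(x⁶+3x⁵+6x⁴+x³−3x²+12x+16)³(2x³+3x²−3x−5)/(x³−3x−1)⁹. For every rational x with x ≠ 1 and x ≠ −1, the value f(x) is not the cube of any rational number: for all z ∈ ℚ, z³ ≠ f(x). -/
/-- The degree-27 rational function f realizing the covering map 𝒳₉ → X(1). -/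
def f (x : ℚ) : ℚ :=
  3 ^ 7 * (x ^ 2 - 1) ^ 3 *
      (x ^ 6 + 3 * x ^ 5 + 6 * x ^ 4 + x ^ 3 - 3 * x ^ 2 + 12 * x + 16) ^ 3 *
      (2 * x ^ 3 + 3 * x ^ 2 - 3 * x - 5) / (x ^ 3 - 3 * x - 1) ^ 9

theorem not_prime_dvd_num_and_den (x : ℚ) {p : ℕ} (hp : p.Prime) :
    ¬ ((p : ℤ) ∣ x.num ∧ (p : ℤ) ∣ x.den) := by
  rintro ⟨h1, h2⟩
  exact Nat.not_coprime_of_dvd_of_dvd hp.one_lt (Int.natCast_dvd.mp h1)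
    (Int.natCast_dvd_natCast.mp h2) x.reduced

/-- If the cube of a rational number is an integer, then it is the cube of an integer. -/
theorem exists_int_cube_eq {w : ℚ} {n : ℤ} (h : w ^ 3 = n) : ∃ c : ℤ, c ^ 3 = n := by
  obtain ⟨c, hc⟩ := IsIntegrallyClosed.exists_algebraMap_eq_of_isIntegral_pow (R := ℤ)
    (K := ℚ) (x := w) (n := 3) (by norm_num) (h ▸ isIntegral_algebraMap (x := n))
  refine ⟨c, ?_⟩
  have hc' : (c : ℚ) = w := hc
  exact_mod_cast hc' ▸ h

theorem cubic_ne_zero (x : ℚ) : x ^ 3 - 3 * x - 1 ≠ 0 := by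
  intro h
  have key : x.num ^ 3 - 3 * x.num * x.den ^ 2 - (x.den : ℤ) ^ 3 = 0 := by
    have hx : (x.num : ℚ) = x * x.den := (Rat.mul_den_eq_num x).symm
    have : (x.num : ℚ) ^ 3 - 3 * x.num * x.den ^ 2 - (x.den : ℚ) ^ 3 = 0 := by
      rw [hx]
      linear_combination (x.den : ℚ) ^ 3 * h
    exact_mod_cast this
  have hcop := not_prime_dvd_num_and_den x Nat.prime_two
  generalize x.num = a at *
  generalize (x.den : ℤ) = b at *
  have key2 := congrArg (Int.cast : ℤ → ZMod 2) key
  push_cast at key2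
  rw [← ZMod.intCast_zmod_eq_zero_iff_dvd, ← ZMod.intCast_zmod_eq_zero_iff_dvd] at hcop
  generalize (a : ZMod 2) = a at *
  generalize (b : ZMod 2) = b at *
  revert a b
  decide

theorem sextic_pos (x : ℚ) :
    0 < x ^ 6 + 3 * x ^ 5 + 6 * x ^ 4 + x ^ 3 - 3 * x ^ 2 + 12 * x + 16 := by
  nlinarith [sq_nonneg (x ^ 3 + 3 / 2 * x ^ 2 + x - 1), sq_nonneg (x ^ 2 + x),
    sq_nonneg (x + 1), sq_nonneg (x ^ 2 - 1)]

/-- The curve `w³ = 3 (2x³ + 3x² - 3x - 5)` has no rational points, by an obstruction modulo `9`. -/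
theorem cube_ne_three_mul (x w : ℚ) : w ^ 3 ≠ 3 * (2 * x ^ 3 + 3 * x ^ 2 - 3 * x - 5) := by
  intro h
  have hx : (x.num : ℚ) = x * x.den := (Rat.mul_den_eq_num x).symm
  obtain ⟨c, hc⟩ := exists_int_cube_eq (w := w * x.den)
    (n := 3 * (2 * x.num ^ 3 + 3 * x.num ^ 2 * x.den - 3 * x.num * x.den ^ 2 - 5 * x.den ^ 3)) (by
      push_cast
      rw [hx]
      linear_combination (x.den : ℚ) ^ 3 * h)
  have hcop := not_prime_dvd_num_and_den x Nat.prime_three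
  generalize x.num = a at *
  generalize (x.den : ℤ) = b at *
  obtain ⟨d, rfl⟩ : 3 ∣ c := Int.prime_three.dvd_of_dvd_pow ⟨_, hc⟩
  obtain ⟨k, rfl⟩ : ∃ k, b = a + 3 * k := by
    have h3 : ((3 : ℕ) : ℤ) ∣ 2 * a ^ 3 + b ^ 3 :=
      ⟨3 * d ^ 3 - a ^ 2 * b + a * b ^ 2 + 2 * b ^ 3, by push_cast; linarith⟩
    have : ((3 : ℕ) : ℤ) ∣ b - a := by
      rw [← ZMod.intCast_zmod_eq_zero_iff_dvd] at h3 ⊢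
      push_cast at h3 ⊢
      generalize (a : ZMod 3) = a at *
      generalize (b : ZMod 3) = b at *
      clear hc hcop
      revert a b
      decide
    obtain ⟨k, hk⟩ := this
    exact ⟨k, by push_cast at hk; linarith⟩
  have ha : 3 ∣ a := by
    refine Int.prime_three.dvd_of_dvd_pow (n := 3)
      ⟨-d ^ 3 - 6 * a ^ 2 * k - 18 * a * k ^ 2 - 15 * k ^ 3, ?_⟩
    linarith
  exact hcop ⟨ha, dvd_add ha ⟨k, rfl⟩⟩

/-- For every rational x ≠ ±1, the value f(x) is not the cube of a rational number. -/
theorem f_not_cube (x : ℚ) (h1 : x ≠ 1) (h2 : x ≠ -1) (z : ℚ) : z ^ 3 ≠ f x := by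
  intro h
  have hq : x ^ 2 - 1 ≠ 0 := by
    rw [show x ^ 2 - 1 = (x - 1) * (x - -1) by ring]
    exact mul_ne_zero (sub_ne_zero.mpr h1) (sub_ne_zero.mpr h2)
  have hc := cubic_ne_zero x
  have hs := (sextic_pos x).ne'
  apply cube_ne_three_mul x (z * (x ^ 3 - 3 * x - 1) ^ 3 / (9 * (x ^ 2 - 1) *
    (x ^ 6 + 3 * x ^ 5 + 6 * x ^ 4 + x ^ 3 - 3 * x ^ 2 + 12 * x + 16)))
  unfold f at h
  rw [eq_div_iff (pow_ne_zero 9 hc)] at h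
  rw [div_pow, div_eq_iff (by positivity)]
  linear_combination h
end

section
/- The only pair of rational numbers (z₁, z₂) satisfying 3z₂³ = z₁(z₁³ + 3z₁² − 6z₁ + 1) is (z₁, z₂) = (0, 0). -/
open NumberField in
/-- Every integer of the third cyclotomic field is an integral combination of `1` and `ζ₃`. -/
theorem exists_int_add_int_mul_toInteger {K : Type*} [Field K] [NumberField K]
    [IsCyclotomicExtension {3} ℚ K] {ζ : K} (hζ : IsPrimitiveRoot ζ 3) (x : 𝓞 K) :
    ∃ p q : ℤ, x = p + q * hζ.toInteger := by
  have hdim : hζ.integralPowerBasis.dim = 2 := by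
    rw [hζ.integralPowerBasis_dim, Nat.totient_prime Nat.prime_three]
  obtain ⟨f, hf, rfl⟩ := hζ.integralPowerBasis.exists_eq_aeval x
  obtain ⟨q, p, rfl⟩ := Polynomial.exists_eq_X_add_C_of_natDegree_le_one (by omega : f.natDegree ≤ 1)
  exact ⟨p, q, by simp [add_comm]⟩

/-- In a domain of characteristic zero, `1` and a root of `X ^ 2 + X + 1` are linearly
independent over `ℤ`. -/
theorem int_add_int_mul_eq_iff {R : Type*} [CommRing R] [CharZero R] {w : R}
    (hw : w ^ 2 + w + 1 = 0) {a b c d : ℤ} :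
    (a + b * w : R) = c + d * w ↔ a = c ∧ b = d := by
  refine ⟨fun h ↦ ?_, by rintro ⟨rfl, rfl⟩; rfl⟩
  have hnorm : (a - c) ^ 2 - (a - c) * (b - d) + (b - d) ^ 2 = 0 := by
    have : (((a - c) ^ 2 - (a - c) * (b - d) + (b - d) ^ 2 : ℤ) : R) = 0 := by
      push_cast
      linear_combination ((a - c) + (b - d) * w ^ 2 : R) * h +
        (-(a - c) * (b - d) - (b - d) ^ 2 * (w - 1) : R) * hw
    exact_mod_cast this
  have hb : b - d = 0 := by
    rw [← sq_eq_zero_iff]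
    nlinarith [sq_nonneg (2 * (a - c) - (b - d)), sq_nonneg (b - d)]
  have ha : a - c = 0 := by simpa [hb] using hnorm
  omega

/-- If `C` is prime to `3 * N` and the norm `C ^ 2 + 9 * C * N + 27 * N ^ 2` of
`C + 6 * N + 3 * N * ω` is a cube, then `C + 6 * N + 3 * N * ω` is itself a cube in `ℤ[ω]`. -/
theorem exists_cube_of_norm_eq_cube {C N Q : ℤ} (hco : IsCoprime C (3 * N))
    (h : C ^ 2 + 9 * C * N + 27 * N ^ 2 = Q ^ 3) :
    ∃ p q : ℤ, p ^ 3 + q ^ 3 - 3 * p * q ^ 2 = C + 6 * N ∧ p * q * (p - q) = N := by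
  let K := CyclotomicField 3 ℚ
  have : IsCyclotomicExtension {3} ℚ K := CyclotomicField.isCyclotomicExtension 3 ℚ
  have hζ := IsCyclotomicExtension.zeta_spec 3 ℚ K
  have : NumberField K := IsCyclotomicExtension.numberField {3} ℚ _
  have : IsPrincipalIdealRing (NumberField.RingOfIntegers K) :=
    IsCyclotomicExtension.Rat.three_pid K
  set w := hζ.toInteger with hwdef
  have hw : w ^ 2 + w + 1 = 0 := by
    have := hζ.toInteger_isPrimitiveRoot.isRoot_cyclotomic (by norm_num)
    simpa [Polynomial.cyclotomic_three] using this
  have hC3 : ¬ (3 : ℤ) ∣ C := fun h3 ↦ by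
    have := (hco.of_mul_right_left).isUnit_of_dvd' h3 dvd_rfl
    exact Int.prime_three.not_isUnit this
  have hmul : ((C + 6 * N : ℤ) + (3 * N : ℤ) * w) * ((C + 3 * N : ℤ) + (-(3 * N) : ℤ) * w) =
      (Q : NumberField.RingOfIntegers K) ^ 3 := by
    have : (C : NumberField.RingOfIntegers K) ^ 2 + 9 * C * N + 27 * N ^ 2 = Q ^ 3 := by
      exact_mod_cast congrArg (Int.cast : ℤ → NumberField.RingOfIntegers K) h
    push_cast
    linear_combination this - 9 * (N : NumberField.RingOfIntegers K) ^ 2 * hw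
  have hcop : IsCoprime ((C + 6 * N : ℤ) + (3 * N : ℤ) * w : NumberField.RingOfIntegers K)
      ((C + 3 * N : ℤ) + (-(3 * N) : ℤ) * w) := by
    have hQ : IsCoprime (Q ^ 3) (3 * N) := by
      rw [← h, show C ^ 2 + 9 * C * N + 27 * N ^ 2 = C ^ 2 + 3 * N * (3 * C + 9 * N) by ring]
      exact hco.pow_left.add_mul_left_left _
    have h3 : IsCoprime (Q ^ 3) 3 := hQ.of_mul_right_left
    have hN : IsCoprime (Q ^ 3) (3 * (3 * N)) := h3.mul_right hQ
    obtain ⟨u, v, huv⟩ := hN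
    have huv' : (u : NumberField.RingOfIntegers K) * Q ^ 3 + v * (3 * (3 * N)) = 1 := by
      exact_mod_cast congrArg (Int.cast : ℤ → NumberField.RingOfIntegers K) huv
    -- the difference of the two factors is `3 * N * (1 + 2 * w)`, and `(1 + 2 * w) ^ 2 = -3`
    refine ⟨u * ((C + 3 * N : ℤ) + (-(3 * N) : ℤ) * w) - v * (1 + 2 * w), v * (1 + 2 * w), ?_⟩
    rw [← hmul] at huv'
    push_cast at huv' ⊢
    linear_combination huv' - 12 * (v : NumberField.RingOfIntegers K) * N * hw
  obtain ⟨x, u, hu⟩ := exists_associated_pow_of_mul_eq_pow' hcop hmul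
  obtain ⟨p, q, rfl⟩ := exists_int_add_int_mul_toInteger hζ x
  rw [← hwdef] at hu
  have hcube : ((p : NumberField.RingOfIntegers K) + q * w) ^ 3 =
      (p ^ 3 + q ^ 3 - 3 * p * q ^ 2 : ℤ) + (3 * (p * q * (p - q)) : ℤ) * w := by
    push_cast
    linear_combination (3 * p * q ^ 2 + q ^ 3 * (w - 1) : NumberField.RingOfIntegers K) * hw
  rw [hcube] at hu
  generalize hA : p ^ 3 + q ^ 3 - 3 * p * q ^ 2 = A at hu
  generalize hB : p * q * (p - q) = B at hu
  have coords {m n : ℤ} (hmn : ((A : ℤ) + (3 * B : ℤ) * w) * (u : NumberField.RingOfIntegers K) =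
      (m : ℤ) + (n : ℤ) * w) : m = C + 6 * N ∧ n = 3 * N :=
    (int_add_int_mul_eq_iff hw).1 (hmn.symm.trans hu)
  have hη : ((hζ.toInteger_isPrimitiveRoot.isUnit (by decide)).unit :
      NumberField.RingOfIntegers K) = w := rfl
  have hmem := IsCyclotomicExtension.Rat.Three.Units.mem hζ u
  simp only [List.mem_cons, List.not_mem_nil, or_false] at hmem
  rcases hmem with rfl | rfl | rfl | rfl | rfl | rfl
  · obtain ⟨h1, h2⟩ := coords (m := A) (n := 3 * B) (by simp)
    exact ⟨p, q, by omega, by omega⟩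
  · obtain ⟨h1, h2⟩ := coords (m := -A) (n := -(3 * B)) (by push_cast; ring)
    exact ⟨-p, -q, by linear_combination h1 - hA, by linarith [hB]⟩
  · obtain ⟨h1, h2⟩ := coords (m := -(3 * B)) (n := A - 3 * B) (by
      rw [hη]; push_cast; linear_combination (3 * B : NumberField.RingOfIntegers K) * hw)
    omega
  · obtain ⟨h1, h2⟩ := coords (m := 3 * B) (n := 3 * B - A) (by
      rw [Units.val_neg, hη]; push_cast
      linear_combination -(3 * B : NumberField.RingOfIntegers K) * hw)
    omega
  · obtain ⟨h1, h2⟩ := coords (m := 3 * B - A) (n := -A) (by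
      rw [Units.val_pow_eq_pow_val, hη]; push_cast
      linear_combination (A + 3 * B * (w - 1) : NumberField.RingOfIntegers K) * hw)
    omega
  · obtain ⟨h1, h2⟩ := coords (m := A - 3 * B) (n := A) (by
      rw [Units.val_neg, Units.val_pow_eq_pow_val, hη]; push_cast
      linear_combination -(A + 3 * B * (w - 1) : NumberField.RingOfIntegers K) * hw)
    omega

/-- The product of coprime integers and their difference is a cube only if it vanishes. -/
theorem mul_mul_sub_eq_cube {p q T : ℤ} (hco : IsCoprime p q) (h : p * q * (p - q) = T ^ 3) :
    T = 0 := by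
  have hodd : Odd 3 := by decide
  have hp : IsCoprime p (p - q) := by
    simpa [sub_eq_neg_add] using hco.neg_right.add_mul_left_right 1
  have hq : IsCoprime q (p - q) := by
    simpa [sub_eq_add_neg] using hco.symm.add_mul_left_right (-1)
  obtain ⟨⟨d, hd⟩, z, hz⟩ := Int.eq_pow_of_mul_eq_pow_odd (hp.mul_left hq) hodd h
  obtain ⟨⟨x, rfl⟩, y, rfl⟩ := Int.eq_pow_of_mul_eq_pow_odd hco hodd hd
  have hflt := fermatLastTheoremFor_iff_int.1 fermatLastTheoremThree z y x
  by_contra hT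
  have hT3 : x ^ 3 * y ^ 3 * z ^ 3 ≠ 0 := by rw [← hz, h]; positivity
  refine hflt ?_ ?_ ?_ (by linarith) <;> rintro rfl <;> simp at hT3

/-- Integral form of the main theorem. -/
theorem eq_zero_of_mul_sq_mul_cubic_eq {a b c : ℤ} (hab : IsCoprime a b) (hb : b ≠ 0)
    (h : a * b ^ 2 * (a ^ 3 + 3 * a ^ 2 * b - 6 * a * b ^ 2 + b ^ 3) = 3 * c ^ 3) : a = 0 := by
  have hodd : Odd 3 := by decide
  have p3 := Int.prime_three
  obtain ⟨f, hf⟩ : ∃ f, f = a ^ 3 + 3 * a ^ 2 * b - 6 * a * b ^ 2 + b ^ 3 := ⟨_, rfl⟩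
  rw [← hf] at h
  have hf3 : ¬ 3 ∣ f := by
    intro h3
    have hs : (3 : ℤ) ∣ a + b := by
      refine p3.dvd_of_dvd_pow (n := 3) ?_
      rw [show (a + b) ^ 3 = f + 3 * (3 * a * b ^ 2) by rw [hf]; ring]
      exact h3.add (dvd_mul_right _ _)
    obtain ⟨k, hk⟩ := hs
    obtain rfl : a = 3 * k - b := by linarith
    have hc : 3 ∣ c := by
      refine p3.dvd_of_dvd_pow (n := 3) ⟨(3 * k - b) * b ^ 2 * (3 * k ^ 3 - 3 * k * b ^ 2 + b ^ 3), ?_⟩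
      rw [hf] at h
      linarith
    obtain ⟨e, rfl⟩ := hc
    have hb3 : 3 ∣ b := by
      refine p3.dvd_of_dvd_pow (n := 6)
        ⟨(k * b ^ 5 + (3 * k - b) * b ^ 2 * (k ^ 3 - k * b ^ 2)) - 3 * e ^ 3, ?_⟩
      rw [hf] at h
      linarith
    exact p3.not_isUnit (hab.isUnit_of_dvd' ((dvd_mul_right _ _).sub hb3) hb3)
  have hfab : IsCoprime f (a * b ^ 2) := by
    refine IsCoprime.mul_right ?_ (IsCoprime.pow_right ?_)
    · rw [show f = b ^ 3 + a * (a ^ 2 + 3 * a * b - 6 * b ^ 2) by rw [hf]; ring]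
      exact hab.symm.pow_left.add_mul_left_left _
    · rw [show f = a ^ 3 + b * (3 * a ^ 2 - 6 * a * b + b ^ 2) by rw [hf]; ring]
      exact hab.pow_left.add_mul_left_left _
  obtain ⟨m, hm⟩ : 3 ∣ a * b ^ 2 := (p3.dvd_or_dvd ⟨_, h⟩).resolve_right hf3
  rw [hm] at hfab
  obtain ⟨⟨C, rfl⟩, D, rfl⟩ := Int.eq_pow_of_mul_eq_pow_odd (c := c) hfab.of_mul_right_right hodd
    (by rw [hm] at h; linarith)
  have hCD : IsCoprime C (3 * D ^ 3) := (IsCoprime.pow_left_iff (by norm_num)).1 hfab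
  obtain ⟨t, ht⟩ : 3 ∣ a + b - C := by
    refine p3.dvd_of_dvd_pow (n := 3) ⟨9 * D ^ 3 - (a + b) * C * (a + b - C), ?_⟩
    linear_combination -hf + 9 * hm
  obtain rfl : a = 3 * t + C - b := by linarith
  have ht' : t * (C ^ 2 + 3 * C * t + 3 * t ^ 2) = 3 * D ^ 3 := by
    linarith
  have hC3 : ¬ (3 : ℤ) ∣ C := fun h3 ↦ hf3 (h3.trans (dvd_pow_self _ (by norm_num)))
  obtain ⟨N, rfl⟩ : 3 ∣ t := by
    have : 3 ∣ t * C ^ 2 := ⟨D ^ 3 - t * (C * t + t ^ 2), by linarith⟩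
    exact (p3.dvd_or_dvd this).resolve_right fun h3 ↦ hC3 (p3.dvd_of_dvd_pow h3)
  have hN : N * (C ^ 2 + 9 * C * N + 27 * N ^ 2) = D ^ 3 := by linarith
  have hCN : IsCoprime C N := hCD.of_mul_right_right.of_isCoprime_of_dvd_right ⟨_, hN.symm⟩
  have hNQ : IsCoprime N (C ^ 2 + 9 * C * N + 27 * N ^ 2) := by
    rw [show C ^ 2 + 9 * C * N + 27 * N ^ 2 = C ^ 2 + N * (9 * C + 27 * N) by ring]
    exact hCN.symm.pow_right.add_mul_left_right _
  obtain ⟨⟨T, hT⟩, Q, hQ⟩ := Int.eq_pow_of_mul_eq_pow_odd hNQ hodd hN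
  have hC3N : IsCoprime C (3 * N) := hCD.of_mul_right_left.mul_right hCN
  obtain ⟨p, q, hpq, hpqN⟩ := exists_cube_of_norm_eq_cube hC3N hQ
  have hco : IsCoprime p q := by
    obtain ⟨u, v, huv⟩ := hC3N
    refine ⟨u * (p ^ 2 - 3 * q ^ 2) + (v - 2 * u) * (3 * q * (p - q)), u * q ^ 2, ?_⟩
    linear_combination huv + u * hpq + 3 * (v - 2 * u) * hpqN
  have hT0 : T = 0 := mul_mul_sub_eq_cube hco (hpqN.trans hT)
  subst hT0
  have hN0 : N = 0 := by simpa using hT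
  have hD : D ^ 3 = 0 := by rw [← hN, hN0, zero_mul]
  rw [hD, mul_zero] at hm
  exact (mul_eq_zero.1 hm).resolve_right (pow_ne_zero 2 hb)

/-- The only rational point (z₁, z₂) on the affine model 3z₂³ = z₁(z₁³ + 3z₁² - 6z₁ + 1)
of the genus-3 curve 𝒳₉′ is (0, 0). -/
theorem X9prime_only_rational_point (z₁ z₂ : ℚ)
    (h : 3 * z₂ ^ 3 = z₁ * (z₁ ^ 3 + 3 * z₁ ^ 2 - 6 * z₁ + 1)) :
    z₁ = 0 ∧ z₂ = 0 := by
  have hz₁ : z₁ = 0 := by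
    rw [← Rat.num_eq_zero]
    have hz : z₁ * (z₁.den : ℤ) = z₁.num := by exact_mod_cast Rat.mul_den_eq_num z₁
    have hco : IsCoprime z₁.num (z₁.den : ℤ) := by
      rw [Int.isCoprime_iff_nat_coprime]
      exact z₁.reduced
    have hd : (z₁.den : ℤ) ≠ 0 := by exact_mod_cast z₁.den_nz
    generalize z₁.num = a at hz hco ⊢
    generalize (z₁.den : ℤ) = b at hz hco hd
    have key : ((9 * (a * b ^ 2 * (a ^ 3 + 3 * a ^ 2 * b - 6 * a * b ^ 2 + b ^ 3)) : ℤ) : ℚ) =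
        (3 * (z₂ * b ^ 2)) ^ 3 := by
      push_cast
      rw [← hz]
      linear_combination -9 * (b : ℚ) ^ 6 * h
    obtain ⟨c, hc⟩ : ∃ c : ℤ, (c : ℚ) = 3 * (z₂ * b ^ 2) := by
      have hint : IsIntegral ℤ (3 * (z₂ * b ^ 2)) := by
        refine IsIntegral.of_pow (n := 3) (by norm_num) ?_
        rw [← key]
        exact isIntegral_algebraMap
      exact IsIntegrallyClosed.isIntegral_iff.1 hint
    rw [← hc] at key
    have hc3 : 9 * (a * b ^ 2 * (a ^ 3 + 3 * a ^ 2 * b - 6 * a * b ^ 2 + b ^ 3)) = c ^ 3 := by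
      exact_mod_cast key
    obtain ⟨e, rfl⟩ : 3 ∣ c :=
      Int.prime_three.dvd_of_dvd_pow ((show (3 : ℤ) ∣ 9 by norm_num).trans ⟨_, hc3.symm⟩)
    exact eq_zero_of_mul_sq_mul_cubic_eq (c := e) hco hd (by linarith)
  subst hz₁
  simpa using h
end

section
/- Let z₁, z₂ be rational numbers with z₂ ≠ 0 and 3z₂³ = z₁(z₁³ + 3z₁² − 6z₁ + 1). Put X = z₁(z₁+1)/z₂² and Y = 3z₁²/z₂³. Then Y² + Y = X³. -/
/-- The map (z₁, z₂) ↦ (X, Y) = (z₁(z₁+1)/z₂², 3z₁²/z₂³) sends rational points of the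
curve 3z₂³ = z₁(z₁³ + 3z₁² - 6z₁ + 1) with z₂ ≠ 0 to rational points of the elliptic
curve Y² + Y = X³. -/
theorem map_to_elliptic (z₁ z₂ : ℚ) (hz : z₂ ≠ 0)
    (h : 3 * z₂ ^ 3 = z₁ * (z₁ ^ 3 + 3 * z₁ ^ 2 - 6 * z₁ + 1)) :
    (3 * z₁ ^ 2 / z₂ ^ 3) ^ 2 + 3 * z₁ ^ 2 / z₂ ^ 3 = (z₁ * (z₁ + 1) / z₂ ^ 2) ^ 3 := by
  have key : 9 * z₁ ^ 4 + z₁ ^ 2 * (3 * z₂ ^ 3) = (z₁ * (z₁ + 1)) ^ 3 := by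
    rw [h]
    ring
  calc (3 * z₁ ^ 2 / z₂ ^ 3) ^ 2 + 3 * z₁ ^ 2 / z₂ ^ 3
      = (9 * z₁ ^ 4 + z₁ ^ 2 * (3 * z₂ ^ 3)) / z₂ ^ 6 := by
        field_simp
        ring
    _ = (z₁ * (z₁ + 1) / z₂ ^ 2) ^ 3 := by
        rw [key, div_pow, ← pow_mul]
end

section
/- The only rational solutions (x, z) of the equation x³ − 3x − 1 = 3z³ have x = 1, x = −2, or x = −1/2 (with corresponding z-values −1, −1, and 1/2). -/
/-- A rational root of `X³ + aX² + bX + c`, where `c` is odd and `a + b` is odd, does not exist,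
since the cubic is irreducible modulo `2`. -/
theorem Rat.cubic_ne_zero_of_odd {a b c : ℤ} (hab : Odd (a + b)) (hc : Odd c) (x : ℚ) :
    x ^ 3 + a * x ^ 2 + b * x + c ≠ 0 := by
  intro h
  have hden : (x.den : ℚ) ≠ 0 := by exact_mod_cast x.den_nz
  have hnum : x * x.den = x.num := Rat.mul_den_eq_num x
  have key : x.num ^ 3 + a * x.num ^ 2 * x.den + b * x.num * x.den ^ 2 + c * (x.den : ℤ) ^ 3
      = 0 := by
    have : (x.num : ℚ) ^ 3 + a * x.num ^ 2 * x.den + b * x.num * x.den ^ 2 + c * x.den ^ 3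
        = 0 := by
      rw [← hnum]
      linear_combination (x.den : ℚ) ^ 3 * h
    exact_mod_cast this
  have hcop : ¬ (Even x.num ∧ Even (x.den : ℤ)) := by
    rintro ⟨hm, hn⟩
    have h2 := Nat.dvd_gcd (Int.natAbs_dvd_natAbs.mpr hm.two_dvd)
      (Int.natAbs_dvd_natAbs.mpr hn.two_dvd)
    have hred : x.num.natAbs.gcd x.den = 1 := x.reduced
    simp [hred] at h2
  have heven := congrArg Even key
  have hc' : ¬ Even c := Int.not_even_iff_odd.mpr hc
  have hab' : ¬ Even (a + b) := Int.not_even_iff_odd.mpr hab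
  simp only [Int.even_add, Int.even_mul, Int.even_pow, Even.zero, eq_iff_iff] at heven hab'
  tauto

/-- The rational solutions (x, z) of x³ - 3x - 1 = 3z³ are exactly
(1, -1), (-2, -1) and (-1/2, 1/2). -/
theorem rational_points_x3_3x_1_eq_3z3 (x z : ℚ) :
    x ^ 3 - 3 * x - 1 = 3 * z ^ 3 ↔
      (x = 1 ∧ z = -1) ∨ (x = -2 ∧ z = -1) ∨ (x = -1/2 ∧ z = 1/2) := by
  constructor
  · intro h
    have hz : z ≠ 0 := by
      rintro rfl
      refine Rat.cubic_ne_zero_of_odd (a := 0) (b := -3) (c := -1) (by decide) (by decide) x ?_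
      push_cast
      linear_combination h
    have hQ : x ^ 2 + x + 1 ≠ 0 := by nlinarith [sq_nonneg (x + 1 / 2)]
    -- The syzygy between the covariants of the cubic form maps the curve to the Fermat cubic.
    have hfermat : (9 * z ^ 3 + (x ^ 3 + 6 * x ^ 2 + 3 * x - 1)) ^ 3 +
        (9 * z ^ 3 - (x ^ 3 + 6 * x ^ 2 + 3 * x - 1)) ^ 3 =
        (6 * z * (x ^ 2 + x + 1)) ^ 3 := by
      linear_combination (-54 * z ^ 3) * (3 * z ^ 3 + (x ^ 3 - 3 * x - 1)) * 3 * h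
    have hzero : 9 * z ^ 3 + (x ^ 3 + 6 * x ^ 2 + 3 * x - 1) = 0 ∨
        9 * z ^ 3 - (x ^ 3 + 6 * x ^ 2 + 3 * x - 1) = 0 := by
      by_contra! hne
      exact fermatLastTheoremFor_iff_rat.mp fermatLastTheoremThree _ _ _ hne.1 hne.2
        (by positivity) hfermat
    have hx : (x - 1) * ((x + 2) * (2 * x + 1)) = 0 := by
      rcases hzero with h0 | h0
      · linear_combination h0 / 2 + 3 / 2 * h
      · refine absurd ?_ (Rat.cubic_ne_zero_of_odd (a := -3) (b := -6) (c := -1)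
          (by decide) (by decide) x)
        push_cast
        linear_combination h0 / 2 + 3 / 2 * h
    have hinj : ∀ w : ℚ, z ^ 3 = w ^ 3 → z = w := fun w hw =>
      (Odd.strictMono_pow (by decide : Odd 3)).injective hw
    rcases mul_eq_zero.mp hx with h1 | h1
    · obtain rfl : x = 1 := by linarith
      exact Or.inl ⟨rfl, hinj _ (by linarith)⟩
    rcases mul_eq_zero.mp h1 with h1 | h1
    · obtain rfl : x = -2 := by linarith
      exact Or.inr (Or.inl ⟨rfl, hinj _ (by linarith)⟩)
    · obtain rfl : x = -1 / 2 := by linarith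
      exact Or.inr (Or.inr ⟨rfl, hinj _ (by linarith)⟩)
  · rintro (⟨rfl, rfl⟩ | ⟨rfl, rfl⟩ | ⟨rfl, rfl⟩) <;> norm_num
end

section
/- The integer solutions (m, n) of the Thue equation m³ − 3mn² − n³ = 1 are exactly the six pairs (1,0), (0,−1), (−1,1), (2,1), (1,−3), (−3,2). -/
section ThueForm

open Real

/-- The real root `2 cos (π / 9)` of `X ^ 3 - 3 * X - 1` that approximates the ratio of the
coordinates of a solution of the Thue equation in the first quadrant. -/
noncomputable def thueRoot : ℝ := 2 * cos (π / 9)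

/-- The cubic form `x ^ 3 - 3 * x * y ^ 2 - y ^ 3`. -/
def thueForm (x y : ℤ) : ℤ := x ^ 3 - 3 * x * y ^ 2 - y ^ 3

lemma thueRoot_cube : thueRoot ^ 3 = 3 * thueRoot + 1 := by
  have h := cos_three_mul (π / 9)
  rw [show 3 * (π / 9) = π / 3 by ring, cos_pi_div_three] at h
  unfold thueRoot
  linarith

lemma thueRoot_gt : 1.879 < thueRoot := by
  have h1 : 1 ≤ thueRoot := by
    have h : cos (π / 3) ≤ cos (π / 9) :=
      cos_le_cos_of_nonneg_of_le_pi (by positivity) (by linarith [pi_pos]) (by linarith [pi_pos])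
    rw [cos_pi_div_three] at h
    unfold thueRoot
    linarith
  by_contra! h
  nlinarith [thueRoot_cube, mul_nonneg (sub_nonneg.2 h1) (sub_nonneg.2 h)]

lemma thueRoot_lt : thueRoot < 1.8794 := by
  by_contra! h
  nlinarith [thueRoot_cube, sq_nonneg (thueRoot - 1.8794)]

lemma thueForm_cast (x y : ℤ) : (thueForm x y : ℝ) =
    (x - y * thueRoot) * (x ^ 2 + x * y * thueRoot + y ^ 2 * (thueRoot ^ 2 - 3)) := by
  have h := thueRoot_cube
  unfold thueForm
  push_cast
  linear_combination (y : ℝ) ^ 3 * h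

lemma abs_sub_thueRoot_le {x y : ℤ} (hx : 0 < x) (hy : 0 < y) (h : |thueForm x y| = 1) :
    |x - y * thueRoot| * (y : ℝ) ^ 2 ≤ 2 := by
  have hx' : (0 : ℝ) < x := by exact_mod_cast hx
  have hy' : (0 : ℝ) < y := by exact_mod_cast hy
  have h1 := thueRoot_gt
  have h2 : |(x : ℝ) - y * thueRoot| *
      |(x : ℝ) ^ 2 + x * y * thueRoot + y ^ 2 * (thueRoot ^ 2 - 3)| = 1 := by
    rw [← abs_mul, ← thueForm_cast]
    exact_mod_cast h
  have h3 : (y : ℝ) ^ 2 ≤ 2 * |(x : ℝ) ^ 2 + x * y * thueRoot + y ^ 2 * (thueRoot ^ 2 - 3)| := by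
    refine le_trans ?_ (mul_le_mul_of_nonneg_left (le_abs_self _) zero_le_two)
    nlinarith [mul_pos hx' hy', mul_pos (mul_pos hx' hy') (by linarith : 0 < thueRoot),
      mul_nonneg (sq_nonneg (y : ℝ)) (by nlinarith : 0 ≤ thueRoot ^ 2 - 3.5)]
  nlinarith [abs_nonneg ((x : ℝ) - y * thueRoot)]

lemma abs_sub_thueRoot_mul_le {c d : ℤ} (hd : 0 < d) (h : 9 * d ≤ 5 * c) :
    |c - d * thueRoot| * (7 * (d : ℝ) ^ 2) ≤ |(thueForm c d : ℝ)| := by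
  have hd' : (0 : ℝ) < d := by exact_mod_cast hd
  have hc' : (1.8 : ℝ) * d ≤ c := by
    have : (9 : ℝ) * d ≤ 5 * c := by exact_mod_cast h
    linarith
  have h1 := thueRoot_gt
  rw [thueForm_cast, abs_mul]
  refine mul_le_mul_of_nonneg_left (le_trans ?_ (le_abs_self _)) (abs_nonneg _)
  have h2 : (1.8 * d) ^ 2 ≤ (c : ℝ) ^ 2 := by gcongr
  have h3 : (1.8 * d) * d * 1.879 ≤ (c : ℝ) * d * thueRoot := by
    have hc0 : (0 : ℝ) ≤ c := by linarith
    gcongr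
  have h4 : (d : ℝ) ^ 2 * (1.879 ^ 2 - 3) ≤ d ^ 2 * (thueRoot ^ 2 - 3) := by gcongr
  nlinarith

/-- Two rational approximations of `thueRoot` that are too good to be distinct coincide. -/
lemma mul_eq_mul_of_close {x y c d : ℤ} (hy : 0 < y)
    (hxy : |x - y * thueRoot| * (y : ℝ) ^ 2 ≤ 2)
    (h : (y : ℝ) * |c - d * thueRoot| + 2 * |(d : ℝ)| / (y : ℝ) ^ 2 < 1) : c * y = d * x := by
  have hy' : (0 : ℝ) < y := by exact_mod_cast hy
  have h1 : ((c * y - d * x : ℤ) : ℝ) =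
      y * (c - d * thueRoot) - d * (x - y * thueRoot) := by
    push_cast; ring
  have h2 : |((c * y - d * x : ℤ) : ℝ)| < 1 := by
    rw [h1]
    refine lt_of_le_of_lt ((abs_sub _ _).trans (add_le_add ?_ ?_)) h
    · rw [abs_mul, abs_of_pos hy']
    · rw [abs_mul, le_div_iff₀ (by positivity)]
      nlinarith [abs_nonneg (d : ℝ)]
  have h3 : |c * y - d * x| < 1 := by exact_mod_cast h2
  rw [Int.abs_lt_one_iff] at h3
  linarith

lemma isCoprime_of_abs_thueForm_eq_one {x y : ℤ} (h : |thueForm x y| = 1) : IsCoprime x y := by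
  rcases (abs_eq zero_le_one).1 h with h | h
  · exact ⟨x ^ 2 - 3 * y ^ 2, -y ^ 2, by unfold thueForm at h; linarith⟩
  · exact ⟨-(x ^ 2 - 3 * y ^ 2), y ^ 2, by unfold thueForm at h; linarith⟩

/-- A reduced fraction `c / d` close to `thueRoot` excludes a range of solutions. -/
lemma thueForm_ne_of_approx {x y c d : ℤ} (hx : 0 < x) (hy : 0 < y) (h : |thueForm x y| = 1)
    (hd : 0 < d) (hcd : 9 * d ≤ 5 * c) (hco : IsCoprime c d) (hk : |thueForm c d| ≠ 1)
    (hlo : 4 * d < y ^ 2) (hhi : 2 * y * |thueForm c d| < 7 * d ^ 2) : False := by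
  have hy' : (0 : ℝ) < y := by exact_mod_cast hy
  have hd' : (0 : ℝ) < d := by exact_mod_cast hd
  have hlo' : (4 : ℝ) * d < y ^ 2 := by exact_mod_cast hlo
  have hhi' : (2 : ℝ) * y * |(thueForm c d : ℝ)| < 7 * d ^ 2 := by exact_mod_cast hhi
  have h1 : c * y = d * x := by
    refine mul_eq_mul_of_close hy (abs_sub_thueRoot_le hx hy h) ?_
    have h2 := abs_sub_thueRoot_mul_le hd hcd
    have h3 : (y : ℝ) * |c - d * thueRoot| < 1 / 2 := by
      by_contra! hc
      have : (7 * (d : ℝ) ^ 2) * (1 / 2) ≤ (7 * (d : ℝ) ^ 2) * (y * |c - d * thueRoot|) := by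
        gcongr
      nlinarith
    have h4 : 2 * |(d : ℝ)| / (y : ℝ) ^ 2 < 1 / 2 := by
      rw [abs_of_pos hd', div_lt_iff₀ (by positivity)]
      linarith
    linarith
  have hxy := isCoprime_of_abs_thueForm_eq_one h
  have h2 : d ∣ y := hco.symm.dvd_of_dvd_mul_left ⟨x, h1⟩
  have h3 : y ∣ d := hxy.symm.dvd_of_dvd_mul_right ⟨c, by linarith⟩
  have h4 : d = y := Int.dvd_antisymm hd.le hy.le h2 h3
  subst h4
  have h5 : c = x := mul_right_cancel₀ hd.ne' (by linarith)
  subst h5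
  exact hk h

lemma eq_two_one_of_le_five {x y : ℤ} (hx : 0 < x) (hy : 0 < y) (h : |thueForm x y| = 1)
    (hy5 : y ≤ 5) : x = 2 ∧ y = 1 := by
  have hx11 : x ≤ 11 := by
    have h1 := abs_sub_thueRoot_le hx hy h
    have hy' : (1 : ℝ) ≤ y := by exact_mod_cast hy
    have hy5' : (y : ℝ) ≤ 5 := by exact_mod_cast hy5
    have h2 : (x : ℝ) - y * thueRoot ≤ 2 := by
      have h3 := le_abs_self ((x : ℝ) - y * thueRoot)
      have h4 := le_mul_of_one_le_right (abs_nonneg ((x : ℝ) - y * thueRoot))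
        (one_le_pow₀ hy' : (1 : ℝ) ≤ (y : ℝ) ^ 2)
      linarith
    have h3 : (x : ℝ) < 12 := by nlinarith [thueRoot_lt, thueRoot_gt]
    have : x < 12 := by exact_mod_cast h3
    omega
  unfold thueForm at h
  interval_cases y <;> interval_cases x <;> simp_all

/-- The reduced fraction `c / d` excludes the solutions with `l < y ≤ u`. -/
lemma le_of_approx {x y c d l : ℤ} (hx : 0 < x) (h : |thueForm x y| = 1) (hl : l < y) (u : ℤ)
    (hl0 : 0 < l) (hd : 0 < d) (hcd : 9 * d ≤ 5 * c) (hco : Int.gcd c d = 1)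
    (hk : |thueForm c d| ≠ 1)
    (hlo : 4 * d < (l + 1) ^ 2) (hhi : 2 * u * |thueForm c d| < 7 * d ^ 2) : u < y := by
  by_contra! hu
  refine thueForm_ne_of_approx hx (hl0.trans hl) h hd hcd (Int.isCoprime_iff_gcd_eq_one.2 hco) hk
    (hlo.trans_le ?_) (lt_of_le_of_lt ?_ hhi)
  · have : l + 1 ≤ y := hl
    gcongr
  · gcongr

set_option exponentiation.threshold 2000 in
/-- There is no solution other than `(2, 1)` of moderate size in the first quadrant. -/
lemma eq_two_one_of_lt {x y : ℤ} (hx : 0 < x) (hy : 0 < y) (h : |thueForm x y| = 1)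
    (hy0 : y < 4 * 27000 ^ 200) : x = 2 ∧ y = 1 := by
  rcases le_or_gt y 5 with h5 | h0
  · exact eq_two_one_of_le_five hx hy h h5
  exfalso
  have h1 := le_of_approx (c := 15)
    (d := 8)
    hx h h0 10 (by norm_num) (by norm_num) (by norm_num) (by norm_num)
    (by norm_num [thueForm]) (by norm_num) (by norm_num [thueForm])
  have h2 := le_of_approx (c := 47)
    (d := 25)
    hx h h1 29 (by norm_num) (by norm_num) (by norm_num) (by norm_num)
    (by norm_num [thueForm]) (by norm_num) (by norm_num [thueForm])
  have h3 := le_of_approx (c := 374)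
    (d := 199)
    hx h h2 190 (by norm_num) (by norm_num) (by norm_num) (by norm_num)
    (by norm_num [thueForm]) (by norm_num) (by norm_num [thueForm])
  have h4 := le_of_approx (c := 5625)
    (d := 2993)
    hx h h3 (10 ^ 4) (by norm_num) (by norm_num) (by norm_num) (by norm_num)
    (by norm_num [thueForm]) (by norm_num) (by norm_num [thueForm])
  have h5 := le_of_approx (c := 8449857)
    (d := 4496075)
    hx h h4 (7 * 10 ^ 7) (by norm_num) (by norm_num) (by norm_num) (by norm_num)
    (by norm_num [thueForm]) (by norm_num) (by norm_num [thueForm])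
  have h6 := le_of_approx (c := 715196948008558)
    (d := 380548347506659)
    hx h h5 (9 * 10 ^ 14) (by norm_num) (by norm_num) (by norm_num) (by norm_num)
    (by norm_num [thueForm]) (by norm_num) (by norm_num [thueForm])
  have h7 := le_of_approx (c := 185520355368663980462961885959)
    (d := 98713319262582231416489749012)
    hx h h6 (3 * 10 ^ 29) (by norm_num) (by norm_num) (by norm_num) (by norm_num)
    (by norm_num [thueForm]) (by norm_num) (by norm_num [thueForm])
  have h8 := le_of_approx (c := 29184478254217120340067038261677158882922099968980118844819)
    (d := 15528736529722236126061626254710436929957297421033535542512)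
    hx h h7 (2 * 10 ^ 58) (by norm_num) (by norm_num) (by norm_num) (by norm_num)
    (by norm_num [thueForm]) (by norm_num) (by norm_num [thueForm])
  have h9 := le_of_approx (c := 12225027980324799275272371528494982621258866617103569247329941310825998128193056939814434353328670800290125689579317)
    (d := 6504801522278871983339921704361810999325433717200646063211595078748280967167207422958922242251333799344654536153584)
    hx h h8 (8 * 10 ^ 115) (by norm_num) (by norm_num) (by norm_num) (by norm_num)
    (by norm_num [thueForm]) (by norm_num) (by norm_num [thueForm])
  have h10 := le_of_approx (c := 1893589004976118431207326999548103117115335954585887430987917941600883606196553586207887920304858002415528913987555710900734533059475236839716041861583976168922877859300680690113340263959327005844455041745257389728113508520318488211)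
    (d := 1007557664650182311250998839531354984918768646489794553077966307193307296021693916686826326954740372895521145377750136131288963091634705873047927784963736306459173573967980156078594304570207382746904511932315441509708749452080966379)
    hx h h9 (3 * 10 ^ 231) (by norm_num) (by norm_num) (by norm_num) (by norm_num)
    (by norm_num [thueForm]) (by norm_num) (by norm_num [thueForm])
  have h11 := le_of_approx (c := 478882282866896464971837392183997721609111118253046317163194317296712355455012212346434425778515949486075616978010313113516411181982981295621247521545412214644034144498434789327030845907717757570407720364619011607967512420193673395262307912015100154976218252585825479083592656920799012832850662476157495371620466728290364913870886025947748014008099840785295470935519530478235463108673201982908985727114243613366338660457213456045641778734169840137888123190411074)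
    (d := 254807940529736772541682504348839496396707807106384101257971118747309180722741495986004229991906490871351335213596552793235403173768714646770379138505641000236643486168164777046238944807694102044626225885894628213620414493387687169362823446484860518200865157279959710898813357618453798630132867699267652907334838427348327200003240718215981645013013176139603571229328861509493973274564030797610570265123184589960519259383643903053838004942027039299513370070830651)
    hx h h10 (7 * 10 ^ 462) (by norm_num) (by norm_num) (by norm_num) (by norm_num)
    (by norm_num [thueForm]) (by norm_num) (by norm_num [thueForm])
  have h12 := le_of_approx (c := 9780157382408632707600040805108773875714936170208607903661556944454989889366282229783992952072880182599373018731381779846347894141756497059860580240900107319973634424861849442628221770559720954685770136410971713020052516743548309545487591448984244731961751683232028972762226649326330507384048409904898976286171233224523716394091283037874203601013252939986161292722654584503013857064926309274486917976627602700319407157161489260541941853152829979698484297336201380785288244355819639990603290789633776657180656400041252456927359081002458315458140618224358458893934162298527373772403528568625698197459051301910464655672299381108498462738790344674235426130077666574503491599101245285767241097320709111708183090411631099787661724596987750775850988980813371736068495149864473429300870060243359123644860141614237675842501901468029326687481089921224074750282252591622638685728809861828010174007042492346229665278661694409313810781329)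
    (d := 5203913048837733192828378769668453523126837829152663705650524447167372734354061599375940415970837693309827477989748125678600088138585183904414700961353336316624576150942678885536296226767794171954864641140272675198083128861440862429057634323657083682526619266585329679486219542758452830283336209653676592391256206198324354731998584313120553856173844164656907856799796943228796080587925765177242647212868513100109240703567927520584592329553232073636557805247226568706899853599113589733269588590206684000518366461560845149416682812499760964682843888791227353083036117415842128857430810202089186759178320806362385490392268481829452303757780119029851429991040043966013190770511045993614727823903569711707719348603142946443782641257184589852006343515053066944724285615799707585938889982972862868891764224400625968708112408944430176544560181648565856641339752603152378048704160294385216439149020170936105207762405794217462743773854)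
    hx h h11 (4 * 27000 ^ 200) (by norm_num) (by norm_num) (by norm_num) (by norm_num)
    (by norm_num [thueForm]) (by norm_num) (by norm_num [thueForm])
  exact absurd hy0 (not_lt.2 h12.le)

end ThueForm

lemma carry_or {q n j X : ℕ} (hq : 0 < q) (hj : j ≤ n) (hjX : j ≤ X)
    (hX : 3 * X ≡ 3 * n + 1 [MOD q]) (h : 2 * q < 3 * (n % q)) :
    q ≤ j % q + (X - j) % q ∨ q ≤ (n - j) % q + n % q := by
  by_contra! hc
  obtain ⟨h1, h2⟩ := hc
  have h3 := Nat.add_mod j (n - j) q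
  rw [Nat.add_sub_cancel' hj] at h3
  have h4 := Nat.add_mod j (X - j) q
  rw [Nat.add_sub_cancel' hjX, Nat.mod_eq_of_lt h1] at h4
  have hjq := Nat.mod_lt j hq
  have hnq := Nat.mod_lt n hq
  have hXq := Nat.mod_lt X hq
  have h5 : j % q + (n - j) % q = n % q ∨ j % q + (n - j) % q = n % q + q := by
    have htq := Nat.mod_lt (n - j) hq
    rw [h3]
    have hs : j % q + (n - j) % q < 2 * q := by omega
    generalize j % q + (n - j) % q = s at hs ⊢
    rcases lt_or_ge s q with h | h
    · rw [Nat.mod_eq_of_lt h]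
      exact Or.inl rfl
    · rw [Nat.mod_eq_sub_mod h, Nat.mod_eq_of_lt (by omega)]
      omega
  have h6 : 3 * (X % q) ≡ 3 * (n % q) + 1 [MOD q] :=
    ((Nat.mod_modEq X q).mul_left 3).trans
      (hX.trans (((Nat.mod_modEq n q).mul_left 3).add_right 1).symm)
  have h7 : ∃ z : ℤ, 3 * ((n % q : ℕ) : ℤ) + 1 - 3 * ((X % q : ℕ) : ℤ) = q * z := by
    have := h6.dvd
    push_cast at this ⊢
    exact this
  obtain ⟨z, hz⟩ := h7
  have h8 : 3 * ((X % q : ℕ) : ℤ) ≤ 3 * ((n % q : ℕ) : ℤ) + 1 - q := by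
    have hz0 : 0 ≤ z := by
      by_contra! hz0
      have : (q : ℤ) * z ≤ -q := by nlinarith
      omega
    have : z ≠ 0 := by
      rintro rfl
      omega
    have : (q : ℤ) ≤ q * z := by nlinarith [show 1 ≤ z by omega]
    omega
  omega

lemma carry_central {q m n : ℕ} (hq3 : ¬ 3 ∣ q) (hn : n = 4 * m ∨ n = 4 * m + 1)
    (h : q ≤ (3 * m) % q + (3 * m) % q) (hd : ¬ q ∣ 4 * m + 1)
    (hc : ¬ q ≤ m % q + (3 * m) % q) : 2 * q < 3 * (n % q) := by
  have hq : 0 < q := Nat.pos_of_ne_zero (by rintro rfl; simp at hq3)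
  push Not at hc
  have h1 := Nat.mod_add_div m q
  have h2 := Nat.mod_add_div (3 * m) q
  have h3 := Nat.mod_lt m hq
  set a := m % q
  set c := (3 * m) % q
  have h4 : (4 * m) % q = a + c := by
    rw [show 4 * m = m + 3 * m by ring, Nat.add_mod, Nat.mod_eq_of_lt hc]
  have h5 : c = (3 * a) % q := by simp [a, c, Nat.mul_mod]
  have h6 : c = 3 * a := by
    rcases lt_or_ge (3 * a) q with h | h
    · rw [h5, Nat.mod_eq_of_lt h]
    · exfalso
      rw [Nat.mod_eq_sub_mod h] at h5
      rcases lt_or_ge (3 * a - q) q with h' | h'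
      · rw [Nat.mod_eq_of_lt h'] at h5
        omega
      · omega
  rcases hn with rfl | rfl
  · omega
  · have h7 : (4 * m + 1) % q ≠ 0 := fun h => hd (Nat.dvd_of_mod_eq_zero h)
    have h8 : (4 * m + 1) % q = (a + c + 1) % q := by rw [← h4]; simp
    rcases lt_or_ge (a + c + 1) q with h9 | h9
    · rw [h8, Nat.mod_eq_of_lt h9]; omega
    · exfalso
      rw [show a + c + 1 = q by omega, Nat.mod_self] at h8
      exact h7 h8

section PadeArithmetic

open Finset Nat

/-- The exponent of `p` in `padeGain n`. -/
def padeGainExp (n p : ℕ) : ℕ :=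
  if p = 3 then 0 else #{k ∈ Ico 1 (2 * n + 1) | 2 * p ^ k < 3 * (n % p ^ k)}

/-- A common divisor of the coefficients of the normalised Padé polynomials. -/
def padeGain (n : ℕ) : ℕ := ∏ p ∈ range (2 * n + 1) with p.Prime, p ^ padeGainExp n p

lemma padeGain_ne_zero (n : ℕ) : padeGain n ≠ 0 :=
  prod_ne_zero_iff.2 fun _ hp => pow_ne_zero _ (mem_filter.1 hp).2.ne_zero

lemma lt_of_two_mul_pow_lt {n p k : ℕ} (hp : p.Prime) (h : 2 * p ^ k < 3 * (n % p ^ k)) :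
    p ^ k < 2 * n + 1 ∧ k < 2 * n + 1 := by
  have h1 := Nat.mod_le n (p ^ k)
  have h2 := Nat.lt_pow_self hp.one_lt (n := k)
  omega

lemma padeGainExp_eq_zero {n p : ℕ} (hp : p.Prime) (h : 2 * n + 1 ≤ p) : padeGainExp n p = 0 := by
  unfold padeGainExp
  split_ifs with h3
  · rfl
  · rw [Finset.card_eq_zero, filter_eq_empty_iff]
    intro k hk hlt
    have h1 := (lt_of_two_mul_pow_lt hp hlt).1
    have h2 := Nat.le_self_pow (by have := (mem_Ico.1 hk).1; omega : k ≠ 0) p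
    omega

lemma factorization_padeGain {n p : ℕ} (hp : p.Prime) :
    (padeGain n).factorization p = padeGainExp n p := by
  unfold padeGain
  rw [factorization_prod_apply fun q hq => pow_ne_zero _ (mem_filter.1 hq).2.ne_zero]
  rw [sum_congr rfl (g := fun q => if q = p then padeGainExp n p else 0)]
  · rw [sum_ite_eq']
    split_ifs with h
    · rfl
    · rw [padeGainExp_eq_zero hp]
      by_contra! hlt
      exact h (by simp [hlt, hp])
  · intro q hq
    rw [(mem_filter.1 hq).2.factorization_pow, Finsupp.single_apply]
    split_ifs with h
    · rw [h]
    · rfl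

lemma card_filter_le_padeGainExp {n p : ℕ} (hp : p.Prime) (hp3 : p ≠ 3) (b : ℕ) :
    #{k ∈ Ico 1 b | 2 * p ^ k < 3 * (n % p ^ k)} ≤ padeGainExp n p := by
  rw [padeGainExp, if_neg hp3]
  refine card_le_card fun k hk => ?_
  simp only [mem_filter, mem_Ico] at hk ⊢
  exact ⟨⟨hk.1.1, (lt_of_two_mul_pow_lt hp hk.2).2⟩, hk.2⟩

lemma padeGainExp_le_card_filter {n p b : ℕ} (hp3 : p ≠ 3) (hb : 2 * n + 1 ≤ b) :
    padeGainExp n p ≤ #{k ∈ Ico 1 b | 2 * p ^ k < 3 * (n % p ^ k)} := by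
  rw [padeGainExp, if_neg hp3]
  exact card_le_card (filter_subset_filter _ (Ico_subset_Ico_right hb))

lemma exists_three_mul_modEq {Q : ℕ} (hQ : Coprime 3 Q) (n j : ℕ) :
    ∃ X, j ≤ X ∧ 3 * X ≡ 3 * n + 1 [MOD Q] := by
  have hQ0 : 0 < Q := Nat.pos_of_ne_zero (by rintro rfl; simp at hQ)
  obtain ⟨a, -, ha⟩ := exists_mul_mod_eq_of_coprime (3 * n + 1) hQ hQ0.ne'
  refine ⟨a + Q * j, by nlinarith, ?_⟩
  rw [show 3 * (a + Q * j) = 3 * a + Q * (3 * j) by ring]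
  have h1 : 3 * a ≡ 3 * n + 1 [MOD Q] := ha
  simpa [Nat.ModEq] using h1

/-- The product of `3 * (n - i) + 1` over `i < j`. -/
def thirdFactorial (n j : ℕ) : ℕ := ∏ i ∈ range j, (3 * (n - i) + 1)

lemma thirdFactorial_ne_zero (n j : ℕ) : thirdFactorial n j ≠ 0 :=
  prod_ne_zero_iff.2 fun i _ => by omega

lemma thirdFactorial_modEq {Q X n j : ℕ} (hj : j ≤ n) (hjX : j ≤ X)
    (hX : 3 * X ≡ 3 * n + 1 [MOD Q]) :
    thirdFactorial n j ≡ 3 ^ j * (j ! * X.choose j) [MOD Q] := by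
  rw [← descFactorial_eq_factorial_mul_choose, descFactorial_eq_prod_range, ← card_range j,
    ← prod_const, card_range, ← prod_mul_distrib, thirdFactorial]
  refine Nat.ModEq.prod fun i hi => ?_
  have hi := mem_range.1 hi
  refine Nat.ModEq.add_right_cancel' (3 * i) ?_
  rw [show 3 * (n - i) + 1 + 3 * i = 3 * n + 1 by omega,
    show 3 * (X - i) + 3 * i = 3 * X by omega]
  exact hX.symm

lemma padeGainExp_le {n p j X b : ℕ} (hp : p.Prime) (hp3 : p ≠ 3) (hj : j ≤ n) (hjX : j ≤ X)
    (hb : 2 * n + 1 ≤ b) (hX : 3 * X ≡ 3 * n + 1 [MOD p ^ b]) :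
    padeGainExp n p ≤
      (X.choose j).factorization p + ((2 * n - j).choose n).factorization p := by
  have hlog : Nat.log p X < X + b := lt_of_le_of_lt (Nat.log_le_self _ _) (by omega)
  have hlog' : Nat.log p ((n - j) + n) < X + b :=
    lt_of_le_of_lt (Nat.log_le_self _ _) (by omega)
  rw [show 2 * n - j = (n - j) + n by omega, factorization_choose hp hjX hlog,
    factorization_choose' hp hlog']
  refine (padeGainExp_le_card_filter hp3 hb).trans ((card_le_card fun k hk => ?_).trans
    (card_union_le _ _))
  simp only [mem_filter, mem_Ico, mem_union] at hk ⊢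
  obtain ⟨⟨hk1, hk2⟩, hk3⟩ := hk
  have := carry_or (pow_pos hp.pos k) hj hjX (hX.of_dvd (pow_dvd_pow p hk2.le)) hk3
  rw [add_comm ((n - j) % _)] at this
  exact this.imp (fun h => ⟨⟨hk1, by omega⟩, h⟩) fun h => ⟨⟨hk1, by omega⟩, h⟩

lemma padeGain_mul_factorial_dvd {n j : ℕ} (hj : j ≤ n) :
    padeGain n * j ! ∣ 3 ^ (j / 2) * (thirdFactorial n j * (2 * n - j).choose n) := by
  have hC : (2 * n - j).choose n ≠ 0 := (Nat.choose_pos (by omega)).ne'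
  have hT := thirdFactorial_ne_zero n j
  have hTC := mul_ne_zero hT hC
  rw [← factorization_prime_le_iff_dvd (mul_ne_zero (padeGain_ne_zero n) (factorial_ne_zero j))
    (mul_ne_zero (by positivity) hTC)]
  intro p hp
  rw [Nat.factorization_mul (padeGain_ne_zero n) (factorial_ne_zero j),
    Nat.factorization_mul (by positivity) hTC, Finsupp.add_apply, Finsupp.add_apply,
    factorization_padeGain hp]
  by_cases hp3 : p = 3
  · subst hp3
    rw [padeGainExp, if_pos rfl, hp.factorization_pow, Finsupp.single_eq_same]
    have := factorization_factorial_le_div_pred hp j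
    omega
  refine le_trans ?_ (Nat.le_add_left _ _)
  set b := 2 * n + 1 + (padeGainExp n p + (j !).factorization p)
  have hQ : Coprime 3 (p ^ b) :=
    Coprime.pow_right _ ((coprime_primes prime_three hp).2 (Ne.symm hp3))
  obtain ⟨X, hjX, hX⟩ := exists_three_mul_modEq hQ n j
  rw [← hp.pow_dvd_iff_le_factorization hTC]
  have h1 := (thirdFactorial_modEq hj hjX hX).mul_right ((2 * n - j).choose n)
  have h2 : p ^ (padeGainExp n p + (j !).factorization p) ∣ p ^ b := pow_dvd_pow _ (by omega)
  refine (h1.dvd_iff h2).2 ?_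
  have hX0 : X.choose j ≠ 0 := (Nat.choose_pos hjX).ne'
  have h3 := padeGainExp_le hp hp3 hj hjX (by omega) hX
  rw [mul_assoc]
  refine Dvd.dvd.mul_left ?_ _
  rw [hp.pow_dvd_iff_le_factorization (mul_ne_zero (mul_ne_zero (factorial_ne_zero j) hX0) hC),
    Nat.factorization_mul (mul_ne_zero (factorial_ne_zero j) hX0) hC,
    Nat.factorization_mul (factorial_ne_zero j) hX0]
  simp only [Finsupp.add_apply]
  omega

lemma choose_dvd_padeGain_mul {m n : ℕ} (hn : n = 4 * m ∨ n = 4 * m + 1) :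
    (3 * m + 3 * m).choose (3 * m) ∣ padeGain n * ((3 * m + m).choose m * ((4 * m + 1) *
      3 ^ ((3 * m + 3 * m).choose (3 * m)).factorization 3)) := by
  have h1 : (3 * m + m).choose m ≠ 0 := (Nat.choose_pos (by omega)).ne'
  have h2 : (3 * m + 3 * m).choose (3 * m) ≠ 0 := (Nat.choose_pos (by omega)).ne'
  have h3 : (4 * m + 1) * 3 ^ ((3 * m + 3 * m).choose (3 * m)).factorization 3 ≠ 0 := by
    positivity
  have hD := padeGain_ne_zero n
  rw [← factorization_prime_le_iff_dvd h2 (mul_ne_zero hD (mul_ne_zero h1 h3))]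
  intro p hp
  rw [Nat.factorization_mul hD (mul_ne_zero h1 h3), Nat.factorization_mul h1 h3,
    Nat.factorization_mul (by positivity) (by positivity)]
  simp only [Finsupp.add_apply]
  by_cases hp3 : p = 3
  · subst hp3
    rw [hp.factorization_pow, Finsupp.single_eq_same]
    omega
  have hb : Nat.log p (3 * m + 3 * m) < 6 * m + 2 :=
    lt_of_le_of_lt (Nat.log_le_self _ _) (by omega)
  have hb' : Nat.log p (3 * m + m) < 6 * m + 2 :=
    lt_of_le_of_lt (Nat.log_le_self _ _) (by omega)
  have hb'' : 4 * m + 1 < p ^ (6 * m + 2) := by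
    have := Nat.lt_pow_self hp.one_lt (n := 6 * m + 2)
    omega
  rw [factorization_choose' hp hb, factorization_choose' hp hb', factorization_padeGain hp,
    factorization_eq_card_pow_dvd_of_lt hp (by omega) hb'']
  have key : #{i ∈ Ico 1 (6 * m + 2) | p ^ i ≤ 3 * m % p ^ i + 3 * m % p ^ i} ≤
      #{k ∈ Ico 1 (6 * m + 2) | 2 * p ^ k < 3 * (n % p ^ k)} +
      (#{i ∈ Ico 1 (6 * m + 2) | p ^ i ≤ m % p ^ i + 3 * m % p ^ i} +
      #{i ∈ Ico 1 (6 * m + 2) | p ^ i ∣ 4 * m + 1}) := by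
    refine (card_le_card fun k hk => ?_).trans
      ((card_union_le _ _).trans (Nat.add_le_add_left (card_union_le _ _) _))
    simp only [mem_filter, mem_Ico, mem_union] at hk ⊢
    have hq3 : ¬ 3 ∣ p ^ k := fun h =>
      hp3 ((prime_dvd_prime_iff_eq prime_three hp).1 (prime_three.dvd_of_dvd_pow h)).symm
    have := carry_central hq3 hn hk.2
    tauto
  have := card_filter_le_padeGainExp (n := n) hp hp3 (6 * m + 2)
  omega

lemma choose_four_mul_le (m : ℕ) : (3 * m + m).choose m * 27 ^ m ≤ 256 ^ m := by
  have h := add_pow 1 3 (3 * m + m)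
  have h2 : (3 * m + m).choose m * 27 ^ m ≤ (1 + 3) ^ (3 * m + m) := by
    rw [h]
    have := single_le_sum (f := fun k => 1 ^ k * 3 ^ (3 * m + m - k) * (3 * m + m).choose k)
      (fun _ _ => Nat.zero_le _) (mem_range.2 (by omega : m < 3 * m + m + 1))
    refine le_trans (le_of_eq ?_) this
    rw [Nat.add_sub_cancel, pow_mul]
    ring
  refine h2.trans (le_of_eq ?_)
  rw [show 3 * m + m = 4 * m by ring, pow_mul]
  norm_num

lemma cubic_mul_eight_pow_le {m : ℕ} (hm : 200 ≤ m) :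
    36 * m ^ 2 * (4 * m + 1) * 8 ^ m ≤ 9 ^ m := by
  induction m, hm using Nat.le_induction with
  | base => norm_num
  | succ m hm ih =>
    rw [pow_succ 9, pow_succ 8]
    calc 36 * (m + 1) ^ 2 * (4 * (m + 1) + 1) * (8 ^ m * 8)
        = (36 * (m + 1) ^ 2 * (4 * (m + 1) + 1) * 8) * 8 ^ m := by ring
      _ ≤ (36 * m ^ 2 * (4 * m + 1) * 9) * 8 ^ m := by
        refine Nat.mul_le_mul_right _ ?_
        nlinarith [mul_le_mul hm (mul_le_mul hm hm (by omega) (by omega)) (by omega) (by omega)]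
      _ = (36 * m ^ 2 * (4 * m + 1) * 8 ^ m) * 9 := by ring
      _ ≤ 9 ^ m * 9 := Nat.mul_le_mul_right _ ih

lemma six_pow_le_padeGain {m n : ℕ} (hm : 200 ≤ m) (hn : n = 4 * m ∨ n = 4 * m + 1) :
    6 ^ m ≤ padeGain n := by
  set D := padeGain n
  set A := (3 * m + 3 * m).choose (3 * m)
  set B := (3 * m + m).choose m
  have h1 : A ≤ D * (B * ((4 * m + 1) * (6 * m))) := by
    have h3 : 3 ^ A.factorization 3 ≤ 6 * m := by
      have := pow_factorization_choose_le (p := 3) (n := 3 * m + 3 * m) (k := 3 * m) (by omega)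
      exact this.trans (by omega)
    refine (le_of_dvd (Nat.pos_of_ne_zero ?_) (choose_dvd_padeGain_mul hn)).trans (by gcongr)
    have hB : B ≠ 0 := (Nat.choose_pos (by omega)).ne'
    have := padeGain_ne_zero n
    positivity
  have h2 : 64 ^ m ≤ 6 * m * A := by
    have := four_pow_le_two_mul_self_mul_centralBinom (3 * m) (by omega)
    rw [centralBinom, pow_mul, two_mul (3 * m)] at this
    calc 64 ^ m = (4 ^ 3) ^ m := by norm_num
      _ ≤ _ := this
      _ = 6 * m * A := by ring
  have h3 := choose_four_mul_le m
  have h4 := cubic_mul_eight_pow_le hm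
  have h5 : 64 ^ m * 27 ^ m ≤ D * (36 * m ^ 2 * (4 * m + 1)) * 256 ^ m := by
    calc 64 ^ m * 27 ^ m ≤ 6 * m * (D * (B * ((4 * m + 1) * (6 * m)))) * 27 ^ m := by
          gcongr; exact h2.trans (by gcongr)
      _ = D * (36 * m ^ 2 * (4 * m + 1)) * (B * 27 ^ m) := by ring
      _ ≤ _ := by gcongr
  have h6 : 64 ^ m * 27 ^ m * 8 ^ m ≤ D * (9 ^ m) * 256 ^ m := by
    calc 64 ^ m * 27 ^ m * 8 ^ m ≤ D * (36 * m ^ 2 * (4 * m + 1)) * 256 ^ m * 8 ^ m := by gcongr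
      _ = D * (36 * m ^ 2 * (4 * m + 1) * 8 ^ m) * 256 ^ m := by ring
      _ ≤ _ := by gcongr
  have h7 : 6 ^ m * (9 ^ m * 256 ^ m) ≤ D * (9 ^ m * 256 ^ m) := by
    calc 6 ^ m * (9 ^ m * 256 ^ m) = 64 ^ m * 27 ^ m * 8 ^ m := by
          simp only [← mul_pow]; norm_num
      _ ≤ _ := h6
      _ = _ := by ring
  exact Nat.le_of_mul_le_mul_right h7 (by positivity)

end PadeArithmetic

section PadePrimitive

open Finset Polynomial

lemma fwdDiff_iter_inv (N : ℕ) (s : ℂ) (hs : ∀ i ≤ N, s + 3 * i ≠ 0) :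
    (fwdDiff (3 : ℂ))^[N] (fun x => x⁻¹) s =
      (-3) ^ N * N.factorial / ∏ i ∈ range (N + 1), (s + 3 * i) := by
  induction N generalizing s with
  | zero => simp
  | succ N ih =>
    have h1 := ih s fun i hi => hs i (by omega)
    have h2 := ih (s + 3) fun i hi => by
      have := hs (i + 1) (by omega)
      push_cast at this
      rwa [add_assoc, show (3 : ℂ) + 3 * i = 3 * (i + 1) by ring]
    have h3 : ∏ i ∈ range (N + 1), (s + 3 + 3 * (i : ℂ)) =
        ∏ i ∈ range (N + 1), (s + 3 * ((i + 1 : ℕ) : ℂ)) :=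
      prod_congr rfl fun i _ => by push_cast; ring
    have h0 : s ≠ 0 := by simpa using hs 0 (by omega)
    have hN : s + 3 * ((N + 1 : ℕ) : ℂ) ≠ 0 := hs (N + 1) le_rfl
    have hP : ∏ i ∈ range N, (s + 3 * ((i + 1 : ℕ) : ℂ)) ≠ 0 :=
      prod_ne_zero_iff.2 fun i hi => hs (i + 1) (by have := mem_range.1 hi; omega)
    have h4 : ∏ i ∈ range (N + 1), (s + 3 * ((i + 1 : ℕ) : ℂ)) =
        (∏ i ∈ range N, (s + 3 * ((i + 1 : ℕ) : ℂ))) * (s + 3 * ((N + 1 : ℕ) : ℂ)) :=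
      prod_range_succ _ _
    have h5 : ∏ i ∈ range (N + 1), (s + 3 * (i : ℂ)) =
        (∏ i ∈ range N, (s + 3 * ((i + 1 : ℕ) : ℂ))) * s := by
      rw [prod_range_succ', Nat.cast_zero, mul_zero, add_zero]
    have h6 : ∏ i ∈ range (N + 1 + 1), (s + 3 * (i : ℂ)) =
        (∏ i ∈ range N, (s + 3 * ((i + 1 : ℕ) : ℂ))) * (s + 3 * ((N + 1 : ℕ) : ℂ)) * s := by
      rw [prod_range_succ', Nat.cast_zero, mul_zero, add_zero, h4]
    rw [Function.iterate_succ_apply', fwdDiff, h1, h2, h3, h4, h5, h6, Nat.factorial_succ]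
    generalize ∏ i ∈ range N, (s + 3 * ((i + 1 : ℕ) : ℂ)) = P at hP ⊢
    push_cast at hN ⊢
    field_simp
    ring

/-- The primitive of `τ ↦ τ ^ (-3 * n) * p (τ ^ 3)` made up of pure powers, for `p` of degree
at most `2 * n`. -/
noncomputable def padePrimitive (n : ℕ) (p : ℂ[X]) (τ : ℂ) : ℂ :=
  ∑ k ∈ range (2 * n + 1),
    p.coeff k * (τ ^ (3 * k - 3 * n + 1 : ℤ) / (3 * k - 3 * n + 1 : ℤ))

lemma padePrimitive_sum {ι : Type*} (n : ℕ) (s : Finset ι) (c : ι → ℂ) (p : ι → ℂ[X]) (τ : ℂ) :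
    padePrimitive n (∑ i ∈ s, C (c i) * p i) τ = ∑ i ∈ s, c i * padePrimitive n (p i) τ := by
  simp only [padePrimitive, finsetSum_coeff, coeff_C_mul, sum_mul, mul_sum]
  rw [sum_comm]
  simp only [mul_assoc]

lemma hasDerivAt_padePrimitive {n : ℕ} {p : ℂ[X]} (hp : p.natDegree ≤ 2 * n) {τ : ℂ}
    (hτ : τ ≠ 0) : HasDerivAt (padePrimitive n p) (p.eval (τ ^ 3) / τ ^ (3 * n)) τ := by
  have h : HasDerivAt (padePrimitive n p) (∑ k ∈ range (2 * n + 1),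
      p.coeff k * (((3 * k - 3 * n + 1 : ℤ) : ℂ) * τ ^ (3 * k - 3 * n + 1 - 1 : ℤ) /
        (3 * k - 3 * n + 1 : ℤ))) τ :=
    HasDerivAt.fun_sum fun k _ =>
      ((hasDerivAt_zpow _ τ (Or.inl hτ)).div_const _).const_mul _
  convert h using 1
  rw [eval_eq_sum_range' (Nat.lt_succ_of_le hp), sum_div]
  refine sum_congr rfl fun k _ => ?_
  have h3 : ((3 * k - 3 * n + 1 : ℤ) : ℂ) ≠ 0 := by
    exact_mod_cast (by omega : (3 * k - 3 * n + 1 : ℤ) ≠ 0)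
  rw [mul_div_cancel_left₀ _ h3, mul_div_assoc, add_sub_cancel_right, zpow_sub₀ hτ, ← pow_mul]
  norm_cast

lemma padePrimitive_X_sub_C_pow {n N : ℕ} (hN : N ≤ 2 * n) {τ : ℂ} (hτ : τ ≠ 0) :
    padePrimitive n ((X - C (τ ^ 3)) ^ N) τ =
      τ * (τ ^ (3 * N) / τ ^ (3 * n)) * (-3) ^ N * N.factorial /
        ∏ i ∈ range (N + 1), (((1 - 3 * n : ℤ) : ℂ) + 3 * i) := by
  have hne : ∀ i : ℕ, ((1 - 3 * n : ℤ) : ℂ) + 3 * i ≠ 0 := fun i => by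
    exact_mod_cast (by omega : (1 - 3 * n : ℤ) + 3 * i ≠ 0)
  have h := fwdDiff_iter_inv N ((1 - 3 * n : ℤ) : ℂ) fun i _ => hne i
  rw [fwdDiff_iter_eq_sum_shift] at h
  rw [mul_assoc, mul_div_assoc, ← h, mul_sum, padePrimitive]
  rw [← sum_subset (range_mono (by omega : N + 1 ≤ 2 * n + 1))]
  · refine sum_congr rfl fun k hk => ?_
    have hk : k ≤ N := by have := mem_range.1 hk; omega
    have h3 : τ ^ (3 * k - 3 * n + 1 : ℤ) = τ * (τ ^ (3 * k) / τ ^ (3 * n)) := by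
      rw [zpow_add₀ hτ, zpow_sub₀ hτ, zpow_one, mul_comm]
      norm_cast
    have h4 : τ ^ (3 * N) = τ ^ (3 * k) * (τ ^ 3) ^ (N - k) := by
      rw [← pow_mul, ← pow_add]
      congr 1
      omega
    have h5 : (((3 * k - 3 * n + 1 : ℤ) : ℤ) : ℂ) = ((1 - 3 * n : ℤ) : ℂ) + 3 * k := by
      push_cast; ring
    rw [sub_eq_add_neg, ← C_neg, coeff_X_add_C_pow, h3, h4, h5, neg_pow]
    simp only [nsmul_eq_mul, zsmul_eq_mul]
    push_cast
    rw [mul_comm (k : ℂ) 3]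
    ring
  · intro k _ hk
    rw [sub_eq_add_neg, ← C_neg, coeff_X_add_C_pow, Nat.choose_eq_zero_of_lt (by simpa using hk)]
    simp

end PadePrimitive

section PadeNumerator

open Finset Polynomial

/-- The Padé polynomial of `x ↦ x ^ (1 / 3)`, with integral coefficients up to powers of `3`. -/
noncomputable def padeNum (n : ℕ) (x z : ℂ) : ℂ :=
  ∑ l ∈ range (n + 1), 3 ^ (n - l) *
    ((2 * n - l).choose n * thirdFactorial n l / l.factorial : ℂ) * z ^ l * x ^ (n - l)

/-- The factor `∏ (3 * k - 1) * ∏ (3 * k + 1)` that normalises the Padé polynomials. -/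
def padeScale (n : ℕ) : ℕ := (∏ k ∈ range n, (3 * k + 2)) * ∏ k ∈ range (n + 1), (3 * k + 1)

lemma padeScale_pos (n : ℕ) : 0 < padeScale n :=
  Nat.mul_pos (prod_pos fun _ _ => by omega) (prod_pos fun _ _ => by omega)

lemma padeScale_le (n : ℕ) : padeScale n ≤ 9 ^ n * n.factorial ^ 2 := by
  induction n with
  | zero => simp [padeScale]
  | succ n ih =>
    calc padeScale (n + 1) = padeScale n * ((3 * n + 2) * (3 * (n + 1) + 1)) := by
          rw [padeScale, padeScale, prod_range_succ _ (n + 1), prod_range_succ _ n]; ring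
      _ ≤ 9 ^ n * n.factorial ^ 2 * (9 * (n + 1) ^ 2) := Nat.mul_le_mul ih (by nlinarith)
      _ = _ := by rw [Nat.factorial_succ]; ring

lemma prod_mul_thirdFactorial {n l : ℕ} (hl : l ≤ n) :
    (∏ k ∈ range (n - l + 1), (3 * k + 1)) * thirdFactorial n l =
      ∏ k ∈ range (n + 1), (3 * k + 1) := by
  induction l with
  | zero => simp [thirdFactorial]
  | succ l ih =>
    rw [← ih (by omega), show n - (l + 1) + 1 = n - l by omega, thirdFactorial, thirdFactorial,
      prod_range_succ _ l, prod_range_succ _ (n - l)]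
    ring

lemma prod_shift_mul_thirdFactorial {n l : ℕ} (hl : l ≤ n) :
    (∏ i ∈ range (2 * n - l + 1), (((1 - 3 * n : ℤ) : ℂ) + 3 * i)) * thirdFactorial n l =
      (-1) ^ n * padeScale n := by
  rw [show 2 * n - l + 1 = n + (n - l + 1) by omega, prod_range_add, ← prod_range_reflect,
    padeScale, ← prod_mul_thirdFactorial hl, mul_assoc, Nat.cast_mul, Nat.cast_mul, ← mul_assoc,
    ← mul_assoc, ← mul_assoc]
  congr 2
  · rw [Nat.cast_prod]
    have := prod_const (s := range n) (-1 : ℂ)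
    rw [card_range] at this
    rw [← this, ← prod_mul_distrib]
    refine prod_congr rfl fun k hk => ?_
    have hk := mem_range.1 hk
    have h : ((n - 1 - k : ℕ) : ℂ) = n - 1 - k := by
      rw [Nat.cast_sub (by omega), Nat.cast_sub (by omega)]; simp
    rw [h]
    push_cast
    ring
  · rw [Nat.cast_prod]
    refine prod_congr rfl fun k _ => ?_
    push_cast
    ring

lemma padeScale_mul_padePrimitive (n : ℕ) {τ : ℂ} (hτ : τ ≠ 0) (b : ℂ) :
    padeScale n * padePrimitive n ((X - C (τ ^ 3)) ^ n * (X - C b) ^ n) τ =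
      (-1) ^ n * n.factorial ^ 2 * 3 ^ n * (τ * padeNum n (τ ^ 3) (b - τ ^ 3)) := by
  have h : (X - C (τ ^ 3)) ^ n * (X - C b) ^ n = ∑ l ∈ range (n + 1),
      C ((n.choose l : ℂ) * (τ ^ 3 - b) ^ l) * (X - C (τ ^ 3)) ^ (2 * n - l) := by
    rw [show X - C b = C (τ ^ 3 - b) + (X - C (τ ^ 3)) by rw [C_sub]; ring, add_pow, mul_sum]
    refine sum_congr rfl fun l hl => ?_
    have hl := mem_range.1 hl
    rw [show 2 * n - l = n + (n - l) by omega, pow_add, C_mul, ← C_pow, map_natCast]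
    ring
  rw [h, padePrimitive_sum, padeNum, mul_sum, mul_sum, mul_sum]
  refine sum_congr rfl fun l hl => ?_
  have hl : l ≤ n := by have := mem_range.1 hl; omega
  rw [padePrimitive_X_sub_C_pow (by omega) hτ]
  have h1 := prod_shift_mul_thirdFactorial hl
  have hK : (padeScale n : ℂ) ≠ 0 := by exact_mod_cast (padeScale_pos n).ne'
  have hT : (thirdFactorial n l : ℂ) ≠ 0 := by exact_mod_cast thirdFactorial_ne_zero n l
  have h2 : (∏ i ∈ range (2 * n - l + 1), (((1 - 3 * n : ℤ) : ℂ) + 3 * i)) =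
      (-1) ^ n * padeScale n / thirdFactorial n l := by
    rw [← h1, mul_div_cancel_right₀ _ hT]
  have h3 : τ ^ (3 * (2 * n - l)) / τ ^ (3 * n) = (τ ^ 3) ^ (n - l) := by
    rw [div_eq_iff (pow_ne_zero _ hτ), ← pow_mul, ← pow_add]
    congr 1
    omega
  have h4 : (-3 : ℂ) ^ (2 * n - l) = (-1) ^ l * 3 ^ n * 3 ^ (n - l) := by
    rw [show 2 * n - l = n + (n - l) by omega, neg_pow, mul_assoc, ← pow_add]
    congr 1
    refine mul_right_cancel₀ (pow_ne_zero l (by norm_num : (-1 : ℂ) ≠ 0)) ?_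
    rw [← pow_add, ← pow_add, show n + (n - l) + l = 2 * n by omega, ← two_mul]
    simp [pow_mul]
  have h5 : (n.choose l : ℂ) * (2 * n - l).factorial =
      n.factorial ^ 2 * ((2 * n - l).choose n / l.factorial) := by
    have h6 := Nat.choose_mul_factorial_mul_factorial hl
    have h7 := Nat.choose_mul_factorial_mul_factorial (show n ≤ 2 * n - l by omega)
    rw [show 2 * n - l - n = n - l by omega] at h7
    have h8 : (l.factorial : ℂ) ≠ 0 := by exact_mod_cast l.factorial_ne_zero
    rw [mul_div_assoc', eq_div_iff h8]
    norm_cast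
    rw [← h7, ← h6]
    ring
  rw [h2, h3, h4]
  have h9 : (b - τ ^ 3) ^ l = (-1) ^ l * (τ ^ 3 - b) ^ l := by rw [← mul_pow]; ring
  have h10 : ((-1 : ℂ) ^ n) ^ 2 = 1 := by rw [← pow_mul, mul_comm, pow_mul]; simp
  rw [h9]
  generalize (τ ^ 3 - b) ^ l = W
  generalize (-1 : ℂ) ^ n = e at *
  have he : e ≠ 0 := by rintro rfl; simp at h10
  field_simp
  rw [h10]
  linear_combination W * h5

lemma norm_padeNum_sub_le (n : ℕ) {v w : ℂ} {σ : ℝ}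
    (h : ∀ τ ∈ segment ℝ w v, τ ≠ 0 ∧ ‖τ ^ 3 - v ^ 3‖ * ‖τ ^ 3 - w ^ 3‖ ≤ σ * ‖τ‖ ^ 3) :
    ‖v * padeNum n (v ^ 3) (w ^ 3 - v ^ 3) - w * padeNum n (w ^ 3) (v ^ 3 - w ^ 3)‖ ≤
      3 ^ n * σ ^ n * ‖v - w‖ := by
  set p : ℂ[X] := (X - C (v ^ 3)) ^ n * (X - C (w ^ 3)) ^ n with hp
  have hdeg : p.natDegree ≤ 2 * n := by
    refine natDegree_mul_le.trans ?_
    rw [natDegree_pow, natDegree_pow, natDegree_X_sub_C, natDegree_X_sub_C]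
    omega
  have h1 : ‖padePrimitive n p v - padePrimitive n p w‖ ≤ σ ^ n * ‖v - w‖ := by
    refine (convex_segment w v).norm_image_sub_le_of_norm_hasDerivWithin_le
      (fun τ hτ => (hasDerivAt_padePrimitive hdeg (h τ hτ).1).hasDerivWithinAt)
      (fun τ hτ => ?_) (left_mem_segment ℝ w v) (right_mem_segment ℝ w v)
    have hτ0 : 0 < ‖τ‖ := norm_pos_iff.2 (h τ hτ).1
    rw [norm_div, norm_pow, div_le_iff₀ (by positivity), pow_mul, ← mul_pow, hp, eval_mul,
      eval_pow, eval_pow, ← mul_pow, norm_pow]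
    simp only [eval_sub, eval_X, eval_C, norm_mul]
    exact pow_le_pow_left₀ (by positivity) (h τ hτ).2 n
  have hv := padeScale_mul_padePrimitive n (h v (right_mem_segment ℝ w v)).1 (w ^ 3)
  have hw := padeScale_mul_padePrimitive n (h w (left_mem_segment ℝ w v)).1 (v ^ 3)
  rw [mul_comm ((X - C (w ^ 3)) ^ n)] at hw
  have h2 : padeScale n * ‖padePrimitive n p v - padePrimitive n p w‖ =
      n.factorial ^ 2 * 3 ^ n * ‖v * padeNum n (v ^ 3) (w ^ 3 - v ^ 3) -
        w * padeNum n (w ^ 3) (v ^ 3 - w ^ 3)‖ := by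
    have := congrArg norm (congrArg₂ (· - ·) hv hw)
    simp only [← mul_sub, norm_mul, norm_pow, norm_neg, norm_one, one_pow, one_mul,
      Complex.norm_natCast, Complex.norm_ofNat] at this
    exact this
  have h3 : (padeScale n : ℝ) ≤ 9 ^ n * n.factorial ^ 2 := by exact_mod_cast padeScale_le n
  have hf : (0 : ℝ) < n.factorial ^ 2 * 3 ^ n := by positivity
  refine le_of_mul_le_mul_left ?_ hf
  rw [← h2]
  calc (padeScale n : ℝ) * ‖padePrimitive n p v - padePrimitive n p w‖
      ≤ (9 ^ n * n.factorial ^ 2) * (σ ^ n * ‖v - w‖) := by gcongr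
    _ = _ := by
      rw [show (9 : ℝ) = 3 * 3 by norm_num, mul_pow]
      ring

end PadeNumerator

section PadeRecurrence

open Finset

lemma mul_sum_antidiagonal_left {n : ℕ} {x z : ℂ} {f g : ℕ → ℕ → ℂ} (h0 : ∀ l, g 0 l = 0)
    (hs : ∀ i l, g (i + 1) l = f i l) :
    x * ∑ p ∈ antidiagonal n, f p.1 p.2 * x ^ p.1 * z ^ p.2 =
      ∑ p ∈ antidiagonal (n + 1), g p.1 p.2 * x ^ p.1 * z ^ p.2 := by
  rw [Nat.sum_antidiagonal_succ, h0, mul_sum, zero_mul, zero_mul, zero_add]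
  exact sum_congr rfl fun p _ => by rw [hs]; ring

lemma mul_sum_antidiagonal_right {n : ℕ} {x z : ℂ} {f g : ℕ → ℕ → ℂ} (h0 : ∀ i, g i 0 = 0)
    (hs : ∀ i l, g i (l + 1) = f i l) :
    z * ∑ p ∈ antidiagonal n, f p.1 p.2 * x ^ p.1 * z ^ p.2 =
      ∑ p ∈ antidiagonal (n + 1), g p.1 p.2 * x ^ p.1 * z ^ p.2 := by
  rw [Nat.sum_antidiagonal_succ', h0, mul_sum, zero_mul, zero_mul, zero_add]
  exact sum_congr rfl fun p _ => by rw [hs]; ring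

/-- The coefficient of `x ^ i * z ^ l` in `padeNum (i + l) x z / padeScale (i + l)`. -/
noncomputable def padeCoeff (i l : ℕ) : ℂ :=
  3 ^ i * (2 * i + l).factorial / ((i + l).factorial * i.factorial * l.factorial *
    (∏ k ∈ range (i + 1), (3 * k + 1) : ℕ) * (∏ k ∈ range (i + l), (3 * k + 2) : ℕ))

lemma padeNum_div_padeScale (n : ℕ) (x z : ℂ) : padeNum n x z / padeScale n =
    ∑ p ∈ antidiagonal n, padeCoeff p.1 p.2 * x ^ p.1 * z ^ p.2 := by
  rw [← Nat.sum_antidiagonal_swap, Nat.sum_antidiagonal_eq_sum_range_succ_mk, padeNum, sum_div]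
  refine sum_congr rfl fun l hl => ?_
  have hl : l ≤ n := by have := mem_range.1 hl; omega
  simp only [Prod.swap, padeCoeff]
  rw [show n - l + l = n by omega, show 2 * (n - l) + l = 2 * n - l by omega]
  have h7 := Nat.choose_mul_factorial_mul_factorial (show n ≤ 2 * n - l by omega)
  rw [show 2 * n - l - n = n - l by omega] at h7
  have h1 := prod_mul_thirdFactorial hl
  rw [padeScale, ← h1, ← h7]
  have hT : (thirdFactorial n l : ℂ) ≠ 0 := by exact_mod_cast thirdFactorial_ne_zero n l
  have hS : ((∏ k ∈ range (n - l + 1), (3 * k + 1) : ℕ) : ℂ) ≠ 0 := by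
    exact_mod_cast (prod_pos fun _ _ => by omega).ne'
  have hU : ((∏ k ∈ range n, (3 * k + 2) : ℕ) : ℂ) ≠ 0 := by
    exact_mod_cast (prod_pos fun _ _ => by omega).ne'
  have hf : ∀ m : ℕ, (m.factorial : ℂ) ≠ 0 := fun m => by exact_mod_cast m.factorial_ne_zero
  have hf1 := hf l
  have hf2 := hf n
  have hf3 := hf (n - l)
  rw [Nat.cast_mul, Nat.cast_mul, Nat.cast_mul, Nat.cast_mul]
  field_simp

lemma padeCoeff_succ_left (i l : ℕ) :
    (i + 1 + l : ℂ) * (i + 1) * (3 * (i + 1) + 1) * (3 * (i + 1 + l) - 1) /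
      (3 * ((2 * (i + 1) + l) * (2 * (i + 1) + l - 1))) * padeCoeff (i + 1) l =
      padeCoeff i l := by
  unfold padeCoeff
  rw [show 2 * (i + 1) + l = 2 * i + l + 1 + 1 by ring, show i + 1 + l = i + l + 1 by ring,
    prod_range_succ _ (i + 1), prod_range_succ _ (i + l)]
  simp only [Nat.factorial_succ]
  have hS : ((∏ k ∈ range (i + 1), (3 * k + 1) : ℕ) : ℂ) ≠ 0 := by
    exact_mod_cast (prod_pos fun _ _ => by omega).ne'
  have hU : ((∏ k ∈ range (i + l), (3 * k + 2) : ℕ) : ℂ) ≠ 0 := by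
    exact_mod_cast (prod_pos fun _ _ => by omega).ne'
  have hf : ∀ m : ℕ, (m.factorial : ℂ) ≠ 0 := fun m => by exact_mod_cast m.factorial_ne_zero
  have hf1 := hf l
  have hf2 := hf i
  have hf3 := hf (i + l)
  have h1 : (2 * i + l + 1 + 1 : ℂ) ≠ 0 := by exact_mod_cast (2 * i + l + 1).succ_ne_zero
  have h2 : (2 * i + l + 1 : ℂ) ≠ 0 := by exact_mod_cast (2 * i + l).succ_ne_zero
  have h3 : (i + 1 : ℂ) ≠ 0 := Nat.cast_add_one_ne_zero i
  have h4 : (i + l + 1 : ℂ) ≠ 0 := by exact_mod_cast (i + l).succ_ne_zero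
  have h5 : (3 * (i + 1) + 1 : ℂ) ≠ 0 := by exact_mod_cast (3 * (i + 1)).succ_ne_zero
  have h6 : (3 * (i + l) + 2 : ℂ) ≠ 0 := by exact_mod_cast (3 * (i + l) + 1).succ_ne_zero
  rw [show (2 * (i + 1) + l - 1 : ℂ) = 2 * i + l + 1 by ring,
    show (2 * (i + 1) + l : ℂ) = 2 * i + l + 1 + 1 by ring,
    show (3 * (i + 1 + l) - 1 : ℂ) = 3 * (i + l) + 2 by ring,
    show (i + 1 + l : ℂ) = i + l + 1 by ring]
  push_cast at *
  generalize ∏ k ∈ range (i + 1), (3 * (k : ℂ) + 1) = S at *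
  generalize ∏ k ∈ range (i + l), (3 * (k : ℂ) + 2) = U at *
  generalize ((2 * i + l).factorial : ℂ) = A at *
  generalize (2 * i + l + 1 + 1 : ℂ) = c₁ at *
  generalize (2 * i + l + 1 : ℂ) = c₂ at *
  generalize (3 * (i + 1) + 1 : ℂ) = c₃ at *
  generalize (3 * (i + l) + 2 : ℂ) = c₄ at *
  field_simp
  ring

lemma padeCoeff_succ_right (i l : ℕ) :
    (i + (l + 1) : ℂ) * (l + 1) * (3 * (i + (l + 1)) - 1) / (2 * i + (l + 1)) *
      padeCoeff i (l + 1) = padeCoeff i l := by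
  unfold padeCoeff
  rw [show 2 * i + (l + 1) = 2 * i + l + 1 by ring, show i + (l + 1) = i + l + 1 by ring,
    prod_range_succ _ (i + l)]
  simp only [Nat.factorial_succ]
  have hS : ((∏ k ∈ range (i + 1), (3 * k + 1) : ℕ) : ℂ) ≠ 0 := by
    exact_mod_cast (prod_pos fun _ _ => by omega).ne'
  have hU : ((∏ k ∈ range (i + l), (3 * k + 2) : ℕ) : ℂ) ≠ 0 := by
    exact_mod_cast (prod_pos fun _ _ => by omega).ne'
  have hf : ∀ m : ℕ, (m.factorial : ℂ) ≠ 0 := fun m => by exact_mod_cast m.factorial_ne_zero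
  have hf1 := hf l
  have hf2 := hf i
  have hf3 := hf (i + l)
  have h1 : (2 * i + l + 1 : ℂ) ≠ 0 := by exact_mod_cast (2 * i + l).succ_ne_zero
  have h3 : (l + 1 : ℂ) ≠ 0 := Nat.cast_add_one_ne_zero l
  have h4 : (i + l + 1 : ℂ) ≠ 0 := by exact_mod_cast (i + l).succ_ne_zero
  have h6 : (3 * (i + l) + 2 : ℂ) ≠ 0 := by exact_mod_cast (3 * (i + l) + 1).succ_ne_zero
  rw [show (2 * i + (l + 1) : ℂ) = 2 * i + l + 1 by ring,
    show (3 * (i + (l + 1)) - 1 : ℂ) = 3 * (i + l) + 2 by ring,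
    show (i + (l + 1) : ℂ) = i + l + 1 by ring]
  push_cast at *
  generalize ∏ k ∈ range (i + 1), (3 * (k : ℂ) + 1) = S at *
  generalize ∏ k ∈ range (i + l), (3 * (k : ℂ) + 2) = U at *
  generalize ((2 * i + l).factorial : ℂ) = A at *
  generalize (2 * i + l + 1 : ℂ) = c₁ at *
  generalize (3 * (i + l) + 2 : ℂ) = c₂ at *
  field_simp

/-- The three-term recurrence of the normalised Padé polynomials. -/
lemma padeNum_recurrence (n : ℕ) (x z : ℂ) :
    ((n + 1) * (n + 2) * (9 * (n + 2) ^ 2 - 1) : ℂ) *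
        (padeNum (n + 2) x z / padeScale (n + 2)) =
      3 * (n + 1) * (2 * n + 3) * (2 * x + z) * (padeNum (n + 1) x z / padeScale (n + 1)) -
        z ^ 2 * (padeNum n x z / padeScale n) := by
  simp only [padeNum_div_padeScale]
  have hx := mul_sum_antidiagonal_left (n := n + 1) (x := x) (z := z) (f := padeCoeff)
    (g := fun i l => (i + l : ℂ) * i * (3 * i + 1) * (3 * (i + l) - 1) /
      (3 * ((2 * i + l) * (2 * i + l - 1))) * padeCoeff i l)
    (fun l => by simp) (fun i l => by exact_mod_cast padeCoeff_succ_left i l)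
  have hz := fun m => mul_sum_antidiagonal_right (n := m) (x := x) (z := z) (f := padeCoeff)
    (g := fun i l => (i + l : ℂ) * l * (3 * (i + l) - 1) / (2 * i + l) * padeCoeff i l)
    (fun l => by simp) (fun i l => by exact_mod_cast padeCoeff_succ_right i l)
  have hzz := mul_sum_antidiagonal_right (n := n + 1) (x := x) (z := z)
    (f := fun i l => (i + l : ℂ) * l * (3 * (i + l) - 1) / (2 * i + l) * padeCoeff i l)
    (g := fun i l => (i + (l - 1) : ℂ) * (l - 1) * (3 * (i + (l - 1)) - 1) / (2 * i + (l - 1)) *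
      ((i + l : ℂ) * l * (3 * (i + l) - 1) / (2 * i + l) * padeCoeff i l))
    (fun l => by simp) (fun i l => by
      rw [← padeCoeff_succ_right i l]
      push_cast
      simp only [add_sub_cancel_right])
  have hsplit : ∀ k a b : ℂ, k * (2 * x + z) * a - z ^ 2 * b =
      k * (2 * (x * a) + z * a) - z * (z * b) := fun k a b => by ring
  rw [hsplit, hz n, hzz, hz (n + 1), hx]
  simp only [mul_sum, ← sum_add_distrib, ← sum_sub_distrib]
  refine sum_congr rfl fun p hp => ?_
  obtain ⟨i, l⟩ := p
  have hil : i + l = n + 2 := mem_antidiagonal.1 hp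
  have hl : (l : ℂ) = n + 2 - i := by
    rw [eq_sub_iff_add_eq, add_comm]
    exact_mod_cast hil
  have h1 : (2 * i + l : ℂ) ≠ 0 := by exact_mod_cast (by omega : 2 * i + l ≠ 0)
  have h2 : (2 * i + l - 1 : ℂ) ≠ 0 := by
    rw [sub_ne_zero]
    exact_mod_cast (by omega : 2 * i + l ≠ 1)
  have h3 : (2 * i + (l - 1) : ℂ) ≠ 0 := by rwa [← add_sub_assoc]
  simp only []
  rw [hl] at h1 h2 h3 ⊢
  field_simp
  ring

end PadeRecurrence

section ThueApproximants

open Finset ComplexConjugate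

/-- The primitive cube root of unity in the upper half plane. -/
noncomputable def eisOmega : ℂ := ⟨-1 / 2, √3 / 2⟩

lemma eisOmega_sq : eisOmega ^ 2 = -1 - eisOmega := by
  have h : √3 * √3 = 3 := Real.mul_self_sqrt (by norm_num)
  apply Complex.ext
  · simp only [sq, eisOmega, Complex.mul_re, Complex.sub_re, Complex.neg_re, Complex.one_re]
    linarith
  · simp only [sq, eisOmega, Complex.mul_im, Complex.sub_im, Complex.neg_im, Complex.one_im]
    ring

lemma conj_eisOmega : conj eisOmega = -1 - eisOmega := by
  apply Complex.ext
  · simp [eisOmega]; norm_num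
  · simp [eisOmega]

lemma im_add_mul_eisOmega (a b : ℝ) : (a + b * eisOmega : ℂ).im = b * (√3 / 2) := by
  simp [eisOmega]

/-- The numerators of the Padé approximants at the cube `19 + ω` of `exp (π * I / 9) * (2 - ω)`. -/
noncomputable def thuePade (n : ℕ) : ℂ := padeNum n (19 + eisOmega) (-(2 * eisOmega + 1))

lemma conj_padeNum (n : ℕ) (x z : ℂ) : conj (padeNum n x z) = padeNum n (conj x) (conj z) := by
  simp [padeNum, map_sum, map_ofNat]

lemma thuePade_recurrence (n : ℕ) :
    (((n + 1) * (n + 2) * (9 * (n + 2) ^ 2 - 1) : ℝ) : ℂ) *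
        (thuePade (n + 2) / padeScale (n + 2)) =
      ((3 * (n + 1) * (2 * n + 3) * 37 : ℝ) : ℂ) * (thuePade (n + 1) / padeScale (n + 1)) +
        (3 : ℝ) * (thuePade n / padeScale n) := by
  have h := padeNum_recurrence n (19 + eisOmega) (-(2 * eisOmega + 1))
  have h2 : (-(2 * eisOmega + 1)) ^ 2 = -3 := by linear_combination 4 * eisOmega_sq
  rw [h2] at h
  push_cast
  unfold thuePade
  rw [h]
  ring

lemma im_thuePade_mul_conj_ne_zero (n : ℕ) :
    (thuePade (n + 1) / padeScale (n + 1) * conj (thuePade n / padeScale n)).im ≠ 0 := by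
  induction n with
  | zero =>
    simp [thuePade, padeNum, padeScale, sum_range_succ, prod_range_succ, thirdFactorial, eisOmega]
    intro h
    linarith [Real.sqrt_pos.2 (show (0 : ℝ) < 3 by norm_num)]
  | succ n ih =>
    have h := thuePade_recurrence n
    generalize thuePade (n + 2) / padeScale (n + 2) = A at *
    generalize thuePade (n + 1) / padeScale (n + 1) = B at *
    generalize thuePade n / padeScale n = C at *
    intro h0
    apply ih
    have h1 := congrArg Complex.re h
    have h2 := congrArg Complex.im h
    simp only [Complex.re_ofReal_mul, Complex.im_ofReal_mul, Complex.add_re, Complex.add_im] at h1 h2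
    simp only [Complex.mul_im, Complex.conj_re, Complex.conj_im] at h0 ⊢
    linear_combination (-1 / 3 * ((n + 1) * (n + 2) * (9 * (n + 2) ^ 2 - 1) : ℝ)) * h0 -
      1 / 3 * B.im * h1 + 1 / 3 * B.re * h2

/-- The ring of Eisenstein integers. -/
noncomputable def eisensteinIntegers : Subring ℂ where
  carrier := {z | ∃ a b : ℤ, z = a + b * eisOmega}
  zero_mem' := ⟨0, 0, by simp⟩
  one_mem' := ⟨1, 0, by simp⟩
  add_mem' := by
    rintro _ _ ⟨a, b, rfl⟩ ⟨c, d, rfl⟩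
    exact ⟨a + c, b + d, by push_cast; ring⟩
  neg_mem' := by
    rintro _ ⟨a, b, rfl⟩
    exact ⟨-a, -b, by push_cast; ring⟩
  mul_mem' := by
    rintro _ _ ⟨a, b, rfl⟩ ⟨c, d, rfl⟩
    refine ⟨a * c - b * d, a * d + b * c - b * d, ?_⟩
    push_cast
    linear_combination (b * d : ℂ) * eisOmega_sq

/-- `padeGain n` divides the numerator of the `n`-th approximant in the Eisenstein integers. -/
lemma exists_thuePade_eq (n : ℕ) :
    ∃ a b : ℤ, thuePade n = padeGain n * (a + b * eisOmega) := by
  suffices h : ∃ p ∈ eisensteinIntegers, thuePade n = padeGain n * p by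
    obtain ⟨_, ⟨a, b, rfl⟩, h⟩ := h
    exact ⟨a, b, h⟩
  have hterm : ∀ l ∈ range (n + 1), ∃ p ∈ eisensteinIntegers, (3 : ℂ) ^ (n - l) *
      ((2 * n - l).choose n * thirdFactorial n l / l.factorial : ℂ) *
        (-(2 * eisOmega + 1)) ^ l * (19 + eisOmega) ^ (n - l) = padeGain n * p := by
    intro l hl
    obtain ⟨q, hq⟩ := padeGain_mul_factorial_dvd (show l ≤ n by have := mem_range.1 hl; omega)
    have hf : (l.factorial : ℂ) ≠ 0 := by exact_mod_cast l.factorial_ne_zero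
    have hq : (3 : ℂ) ^ (l / 2) * ((2 * n - l).choose n * thirdFactorial n l / l.factorial : ℂ) =
        padeGain n * q := by
      rw [mul_div_assoc', div_eq_iff hf, mul_right_comm, mul_comm ((2 * n - l).choose n : ℂ)]
      exact_mod_cast hq
    have h2 : (-(2 * eisOmega + 1)) ^ 2 = (-1) * 3 := by linear_combination 4 * eisOmega_sq
    refine ⟨3 ^ (n - l) * (-1) ^ (l / 2) * q * (-(2 * eisOmega + 1)) ^ (l % 2) *
      (19 + eisOmega) ^ (n - l), ?_, ?_⟩
    · have h3 : (3 : ℂ) ∈ eisensteinIntegers := ⟨3, 0, by simp⟩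
      have hn : (-1 : ℂ) ∈ eisensteinIntegers := ⟨-1, 0, by simp⟩
      have hq : (q : ℂ) ∈ eisensteinIntegers := ⟨q, 0, by simp⟩
      have hz : -(2 * eisOmega + 1) ∈ eisensteinIntegers := ⟨-1, -2, by push_cast; ring⟩
      have hu : 19 + eisOmega ∈ eisensteinIntegers := ⟨19, 1, by simp⟩
      exact mul_mem (mul_mem (mul_mem (mul_mem (pow_mem h3 _) (pow_mem hn _)) hq)
        (pow_mem hz _)) (pow_mem hu _)
    · conv_lhs => rw [← Nat.div_add_mod l 2, pow_add (-(2 * eisOmega + 1)), pow_mul, h2, mul_pow]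
      rw [Nat.div_add_mod]
      linear_combination (3 ^ (n - l) * (-1) ^ (l / 2) * (-(2 * eisOmega + 1)) ^ (l % 2) *
        (19 + eisOmega) ^ (n - l)) * hq
  choose! p hp hpe using hterm
  refine ⟨∑ l ∈ range (n + 1), p l, sum_mem hp, ?_⟩
  rw [mul_sum, thuePade, padeNum]
  exact sum_congr rfl hpe

/-- Consecutive approximants are not proportional over the integers. -/
lemma thuePade_det_ne_zero {n : ℕ} {a b a' b' : ℤ}
    (h : thuePade n = padeGain n * (a + b * eisOmega))
    (h' : thuePade (n + 1) = padeGain (n + 1) * (a' + b' * eisOmega)) : a' * b ≠ a * b' := by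
  intro heq
  apply im_thuePade_mul_conj_ne_zero n
  have heq : (a' * b : ℝ) = a * b' := by exact_mod_cast heq
  have h1 : thuePade (n + 1) / padeScale (n + 1) * conj (thuePade n / padeScale n) =
      ((padeGain (n + 1) / padeScale (n + 1) * (padeGain n / padeScale n) : ℝ) : ℂ) *
        ((a' + b' * eisOmega) * conj ((a : ℝ) + (b : ℝ) * eisOmega)) := by
    rw [h, h']
    push_cast
    simp only [map_div₀, map_mul, map_natCast, map_add, map_intCast]
    ring
  rw [h1, Complex.im_ofReal_mul]
  simp only [Complex.mul_im, Complex.conj_re, Complex.conj_im, Complex.add_re, Complex.add_im,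
    Complex.mul_re, Complex.ofReal_re, Complex.ofReal_im, Complex.intCast_re, Complex.intCast_im,
    eisOmega]
  linear_combination (-(padeGain (n + 1) / padeScale (n + 1) * (padeGain n / padeScale n)) *
    (√3 / 2)) * heq

lemma norm_sub_mul_norm_sub_le {v τ : ℂ} (hv : 0 < v.re) (hτ : τ ∈ segment ℝ (conj v) v) :
    τ ≠ 0 ∧ ‖τ ^ 3 - v ^ 3‖ * ‖τ ^ 3 - conj v ^ 3‖ ≤
      v.im ^ 2 * (3 * ‖v‖ ^ 2) ^ 2 / v.re ^ 3 * ‖τ‖ ^ 3 := by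
  obtain ⟨a, b, ha, hb, hab, rfl⟩ := hτ
  set τ := a • conj v + b • v with hτdef
  have hre : τ.re = v.re := by
    simp only [hτdef, Complex.add_re, Complex.smul_re, Complex.conj_re, smul_eq_mul]
    linear_combination v.re * hab
  have hle : v.re ≤ ‖τ‖ := hre ▸ Complex.re_le_norm τ
  have hnorm : ‖τ‖ ≤ ‖v‖ := by
    calc ‖τ‖ ≤ ‖a • conj v‖ + ‖b • v‖ := norm_add_le _ _
      _ = (a + b) * ‖v‖ := by
        rw [norm_smul, norm_smul, Complex.norm_conj, Real.norm_of_nonneg ha,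
          Real.norm_of_nonneg hb, add_mul]
      _ = ‖v‖ := by rw [hab, one_mul]
  have hquad : ∀ z : ℂ, ‖z‖ = ‖v‖ → ‖τ ^ 2 + τ * z + z ^ 2‖ ≤ 3 * ‖v‖ ^ 2 := by
    intro z hz
    have h1 := norm_add₃_le (a := τ ^ 2) (b := τ * z) (c := z ^ 2)
    rw [norm_pow, norm_pow, norm_mul, hz] at h1
    have h2 : ‖τ‖ ^ 2 ≤ ‖v‖ ^ 2 := by gcongr
    have h3 : ‖τ‖ * ‖v‖ ≤ ‖v‖ * ‖v‖ := by gcongr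
    linarith
  have hlin : ‖τ - v‖ * ‖τ - conj v‖ ≤ v.im ^ 2 := by
    have h1 : τ - v = (a : ℂ) * (conj v - v) := by
      have hab : (a + b : ℂ) = 1 := by exact_mod_cast hab
      simp only [hτdef, Complex.real_smul]
      linear_combination v * hab
    have h2 : τ - conj v = (b : ℂ) * (v - conj v) := by
      have hab : (a + b : ℂ) = 1 := by exact_mod_cast hab
      simp only [hτdef, Complex.real_smul]
      linear_combination conj v * hab
    have h3 : ‖v - conj v‖ = 2 * |v.im| := by
      rw [Complex.sub_conj, norm_mul, Complex.norm_I, mul_one, Complex.norm_real, Real.norm_eq_abs,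
        abs_mul, abs_two]
    rw [h1, h2, norm_mul, norm_mul, norm_sub_rev, h3, Complex.norm_of_nonneg ha,
      Complex.norm_of_nonneg hb]
    rw [← sq_abs v.im]
    obtain rfl : a = 1 - b := by linarith
    nlinarith [mul_nonneg (sq_nonneg (1 - 2 * b)) (sq_nonneg |v.im|)]
  have h3 : v.re ^ 3 ≤ ‖τ‖ ^ 3 := by gcongr
  refine ⟨fun h => by rw [h, norm_zero] at hle; linarith, ?_⟩
  calc ‖τ ^ 3 - v ^ 3‖ * ‖τ ^ 3 - conj v ^ 3‖
      = ‖τ - v‖ * ‖τ - conj v‖ *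
        (‖τ ^ 2 + τ * v + v ^ 2‖ * ‖τ ^ 2 + τ * conj v + conj v ^ 2‖) := by
        rw [← norm_mul, ← norm_mul, ← norm_mul, ← norm_mul]
        congr 1
        ring
    _ ≤ v.im ^ 2 * ((3 * ‖v‖ ^ 2) * (3 * ‖v‖ ^ 2)) := by
        gcongr
        · exact hquad v rfl
        · exact hquad _ (Complex.norm_conj v)
    _ = v.im ^ 2 * (3 * ‖v‖ ^ 2) ^ 2 / v.re ^ 3 * v.re ^ 3 := by
        field_simp
    _ ≤ _ := by gcongr

/-- The cube root `exp (π * I / 9) * (2 - ω)` of `19 + ω`. -/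
noncomputable def thueCubeRoot : ℂ :=
  ⟨Real.cos (Real.pi / 9), Real.sin (Real.pi / 9)⟩ * (2 - eisOmega)

lemma sin_mul_thueRoot : Real.sin (Real.pi / 9) * thueRoot =
    √3 / 2 * Real.cos (Real.pi / 9) - Real.sin (Real.pi / 9) / 2 := by
  have h := Real.sin_sub (Real.pi / 3) (Real.pi / 9)
  rw [Real.sin_pi_div_three, Real.cos_pi_div_three,
    show Real.pi / 3 - Real.pi / 9 = 2 * (Real.pi / 9) by ring, Real.sin_two_mul] at h
  rw [thueRoot]
  linarith

lemma sin_sq_eq : Real.sin (Real.pi / 9) ^ 2 = 1 - thueRoot ^ 2 / 4 := by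
  rw [Real.sin_sq, thueRoot]
  ring

lemma im_mul_sub_mul_eisOmega (c d : ℝ) :
    ((⟨Real.cos (Real.pi / 9), Real.sin (Real.pi / 9)⟩ : ℂ) * (c - d * eisOmega)).im =
      Real.sin (Real.pi / 9) * (c - d * thueRoot) := by
  simp [eisOmega]
  linear_combination d * sin_mul_thueRoot

lemma thueCubeRoot_cube : thueCubeRoot ^ 3 = 19 + eisOmega := by
  have h : (⟨Real.cos (Real.pi / 9), Real.sin (Real.pi / 9)⟩ : ℂ) ^ 3 = 1 + eisOmega := by
    have hc := Real.cos_three_mul (Real.pi / 9)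
    have hs := Real.sin_three_mul (Real.pi / 9)
    have h1 := Real.sin_sq_add_cos_sq (Real.pi / 9)
    rw [show 3 * (Real.pi / 9) = Real.pi / 3 by ring] at hc hs
    rw [Real.cos_pi_div_three] at hc
    rw [Real.sin_pi_div_three] at hs
    apply Complex.ext
    · simp [pow_succ, eisOmega]
      linear_combination -hc - 3 * Real.cos (Real.pi / 9) * h1
    · simp [pow_succ, eisOmega]
      linear_combination -hs + 3 * Real.sin (Real.pi / 9) * h1
  rw [thueCubeRoot, mul_pow, h]
  linear_combination (-11 - eisOmega ^ 2 + 6 * eisOmega) * eisOmega_sq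

lemma norm_thueCubeRoot_sq : ‖thueCubeRoot‖ ^ 2 = 7 := by
  rw [Complex.sq_norm, thueCubeRoot, map_mul, Complex.normSq_mk, Complex.normSq_apply]
  simp [eisOmega]
  linear_combination 7 * Real.sin_sq_add_cos_sq (Real.pi / 9) +
    (Real.sin (Real.pi / 9) ^ 2 + Real.cos (Real.pi / 9) ^ 2) / 4 *
      Real.mul_self_sqrt (show (0 : ℝ) ≤ 3 by norm_num)

lemma im_thueCubeRoot : thueCubeRoot.im = Real.sin (Real.pi / 9) * (2 - thueRoot) := by
  have h := im_mul_sub_mul_eisOmega 2 1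
  simpa [thueCubeRoot] using h

lemma sin_pi_div_nine_pos : 0 < Real.sin (Real.pi / 9) :=
  Real.sin_pos_of_pos_of_lt_pi (by positivity) (by linarith [Real.pi_pos])

lemma re_thueCubeRoot_pos : 0 < thueCubeRoot.re := by
  have h : thueCubeRoot.re = 5 / 2 * Real.cos (Real.pi / 9) + √3 / 2 * Real.sin (Real.pi / 9) := by
    simp [thueCubeRoot, eisOmega]
    ring
  have hc : 0 < Real.cos (Real.pi / 9) := by
    have := thueRoot_gt
    rw [thueRoot] at this
    linarith
  have hs := sin_pi_div_nine_pos
  rw [h]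
  positivity

lemma thueRoot_gt_sharp : 1.8793 < thueRoot := by
  by_contra! h
  nlinarith [thueRoot_cube, thueRoot_gt, mul_nonneg (sub_nonneg.2 h) (sub_nonneg.2 thueRoot_gt.le)]

lemma thueCubeRoot_ratio_le :
    3 * (thueCubeRoot.im ^ 2 * (3 * ‖thueCubeRoot‖ ^ 2) ^ 2 / thueCubeRoot.re ^ 3) ≤ 0.122 := by
  have h7 := norm_thueCubeRoot_sq
  have him : thueCubeRoot.im ^ 2 ≤ 0.0017057 := by
    rw [im_thueCubeRoot, mul_pow, sin_sq_eq]
    have h1 := thueRoot_gt_sharp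
    have h2 := thueRoot_lt
    calc (1 - thueRoot ^ 2 / 4) * (2 - thueRoot) ^ 2
        ≤ (1 - 1.8793 ^ 2 / 4) * (2 - 1.8793) ^ 2 := by
          gcongr; nlinarith
      _ ≤ 0.0017057 := by norm_num
  have hre := re_thueCubeRoot_pos
  have hsq : thueCubeRoot.re ^ 2 + thueCubeRoot.im ^ 2 = 7 := by
    rw [← h7, Complex.sq_norm, Complex.normSq_apply]
    ring
  have hre1 : 2.6454 ≤ thueCubeRoot.re := by nlinarith
  have hre3 : 2.6454 ^ 3 ≤ thueCubeRoot.re ^ 3 := by gcongr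
  rw [h7, mul_div_assoc', div_le_iff₀ (by positivity)]
  norm_num at hre3 ⊢
  linarith

lemma thuePade_approx {n : ℕ} {a b : ℤ} (h : thuePade n = padeGain n * (a + b * eisOmega)) :
    padeGain n * |((2 * a + b : ℤ) : ℝ) - (a - 3 * b : ℤ) * thueRoot| ≤
      0.122 ^ n * (2 - thueRoot) := by
  have h1 := norm_padeNum_sub_le n fun τ hτ => norm_sub_mul_norm_sub_le re_thueCubeRoot_pos hτ
  have h2 : thueCubeRoot * padeNum n (thueCubeRoot ^ 3) (conj thueCubeRoot ^ 3 - thueCubeRoot ^ 3) =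
      (padeGain n : ℝ) * ((⟨Real.cos (Real.pi / 9), Real.sin (Real.pi / 9)⟩ : ℂ) *
        (((2 * a + b : ℤ) : ℝ) - ((a - 3 * b : ℤ) : ℝ) * eisOmega)) := by
    rw [← map_pow, thueCubeRoot_cube, map_add, conj_eisOmega, map_ofNat,
      show (19 : ℂ) + (-1 - eisOmega) - (19 + eisOmega) = -(2 * eisOmega + 1) by ring, ← thuePade, h,
      thueCubeRoot]
    push_cast
    linear_combination -(padeGain n * (⟨Real.cos (Real.pi / 9), Real.sin (Real.pi / 9)⟩ : ℂ) * b) *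
      eisOmega_sq
  have h3 : conj thueCubeRoot *
      padeNum n (conj thueCubeRoot ^ 3) (thueCubeRoot ^ 3 - conj thueCubeRoot ^ 3) =
      conj (thueCubeRoot *
        padeNum n (thueCubeRoot ^ 3) (conj thueCubeRoot ^ 3 - thueCubeRoot ^ 3)) := by
    rw [map_mul, conj_padeNum, map_sub, map_pow, map_pow, Complex.conj_conj]
  have h4 : ∀ z : ℂ, ‖z - conj z‖ = 2 * |z.im| := fun z => by
    rw [Complex.sub_conj, norm_mul, Complex.norm_I, mul_one, Complex.norm_real, Real.norm_eq_abs,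
      abs_mul, abs_two]
  have hs := sin_pi_div_nine_pos
  have hθ : 0 < 2 - thueRoot := by linarith [thueRoot_lt]
  have him : |thueCubeRoot.im| = Real.sin (Real.pi / 9) * (2 - thueRoot) := by
    rw [im_thueCubeRoot, abs_of_pos (mul_pos hs hθ)]
  rw [h3, h4, h4, h2, Complex.im_ofReal_mul, im_mul_sub_mul_eisOmega, him, abs_mul, abs_mul,
    abs_of_pos hs, Nat.abs_cast, ← mul_pow] at h1
  have h5 := pow_le_pow_left₀ (by have := re_thueCubeRoot_pos; positivity) thueCubeRoot_ratio_le n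
  have h6 := h1.trans (mul_le_mul_of_nonneg_right h5 (by positivity))
  refine le_of_mul_le_mul_left ?_ (mul_pos two_pos hs)
  linarith

lemma thirdFactorial_le {n l : ℕ} (hl : l ≤ n) :
    thirdFactorial n l ≤ 3 ^ l * (l.factorial * (n + 1).choose l) := by
  rw [← Nat.descFactorial_eq_factorial_mul_choose, Nat.descFactorial_eq_prod_range, thirdFactorial,
    ← card_range l, ← prod_const, card_range, ← prod_mul_distrib]
  exact prod_le_prod' fun i hi => by have := mem_range.1 hi; omega

lemma norm_padeNum_mul_le (n : ℕ) (x z : ℂ) :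
    ‖padeNum n x z‖ * (4 * ‖x‖) ≤ 3 ^ n * (2 * ‖z‖ + 4 * ‖x‖) ^ (n + 1) := by
  have h : ∀ l ∈ range (n + 1), ‖(3 : ℂ) ^ (n - l) *
      ((2 * n - l).choose n * thirdFactorial n l / l.factorial : ℂ) * z ^ l * x ^ (n - l)‖ *
        (4 * ‖x‖) ≤
      3 ^ n * ((2 * ‖z‖) ^ l * (4 * ‖x‖) ^ (n + 1 - l) * (n + 1).choose l) := by
    intro l hl
    have hl : l ≤ n := by have := mem_range.1 hl; omega
    have hf : (0 : ℝ) < l.factorial := by exact_mod_cast l.factorial_pos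
    have h1 : ((2 * n - l).choose n : ℝ) ≤ 2 ^ (2 * n - l) := by
      exact_mod_cast Nat.choose_le_two_pow _ _
    have h2 : (thirdFactorial n l : ℝ) / l.factorial ≤ 3 ^ l * (n + 1).choose l := by
      rw [div_le_iff₀ hf]
      have := thirdFactorial_le hl
      have h3 : (thirdFactorial n l : ℝ) ≤ 3 ^ l * (l.factorial * (n + 1).choose l) := by
        exact_mod_cast this
      linarith
    simp only [norm_mul, norm_div, norm_pow, Complex.norm_natCast, Complex.norm_ofNat]
    calc (3 : ℝ) ^ (n - l) * ((2 * n - l).choose n * thirdFactorial n l / l.factorial) * ‖z‖ ^ l *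
          ‖x‖ ^ (n - l) * (4 * ‖x‖)
        = 3 ^ (n - l) * ((2 * n - l).choose n * (thirdFactorial n l / l.factorial)) * ‖z‖ ^ l *
          ‖x‖ ^ (n - l) * (4 * ‖x‖) := by rw [mul_div_assoc]
      _ ≤ 3 ^ (n - l) * (2 ^ (2 * n - l) * (3 ^ l * (n + 1).choose l)) * ‖z‖ ^ l *
          ‖x‖ ^ (n - l) * (4 * ‖x‖) := by gcongr
      _ = 3 ^ n * ((2 * ‖z‖) ^ l * (4 * ‖x‖) ^ (n + 1 - l) * (n + 1).choose l) := by
        obtain ⟨k, rfl⟩ := Nat.exists_eq_add_of_le hl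
        rw [show l + k - l = k by omega, show 2 * (l + k) - l = l + 2 * k by omega,
          show l + k + 1 - l = k + 1 by omega, pow_add 2 l, pow_mul, mul_pow, mul_pow, pow_add 3 l,
          pow_succ, pow_succ]
        norm_num
        ring
  calc ‖padeNum n x z‖ * (4 * ‖x‖)
      ≤ (∑ l ∈ range (n + 1), ‖(3 : ℂ) ^ (n - l) *
        ((2 * n - l).choose n * thirdFactorial n l / l.factorial : ℂ) * z ^ l * x ^ (n - l)‖) *
          (4 * ‖x‖) := by gcongr; exact norm_sum_le _ _
    _ ≤ ∑ l ∈ range (n + 1),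
        3 ^ n * ((2 * ‖z‖) ^ l * (4 * ‖x‖) ^ (n + 1 - l) * (n + 1).choose l) := by
      rw [sum_mul]
      exact sum_le_sum h
    _ ≤ ∑ l ∈ range (n + 1 + 1),
        3 ^ n * ((2 * ‖z‖) ^ l * (4 * ‖x‖) ^ (n + 1 - l) * (n + 1).choose l) :=
      sum_le_sum_of_subset_of_nonneg (range_mono (by omega)) fun _ _ _ => by positivity
    _ = _ := by rw [← mul_sum, add_pow]

lemma norm_thuePade_le (n : ℕ) : ‖thuePade n‖ ≤ 1.05 * 232.65 ^ n := by
  have h := norm_padeNum_mul_le n (19 + eisOmega) (-(2 * eisOmega + 1))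
  have h3 : √3 * √3 = 3 := Real.mul_self_sqrt (by norm_num)
  have hx : ‖19 + eisOmega‖ ^ 2 = 343 := by
    rw [Complex.sq_norm, Complex.normSq_apply]
    simp [eisOmega]
    linarith
  have hz : ‖-(2 * eisOmega + 1)‖ ^ 2 = 3 := by
    rw [Complex.sq_norm, Complex.normSq_apply]
    simp [eisOmega]
    linarith
  have hx1 : ‖19 + eisOmega‖ ≤ 18.5203 := by
    nlinarith [norm_nonneg (19 + eisOmega)]
  have hx2 : 18.5 ≤ ‖19 + eisOmega‖ := by
    nlinarith [norm_nonneg (19 + eisOmega)]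
  have hz1 : ‖-(2 * eisOmega + 1)‖ ≤ 1.7321 := by
    nlinarith [norm_nonneg (-(2 * eisOmega + 1))]
  have h4 : ‖thuePade n‖ * 74 ≤ 3 ^ n * 77.55 ^ (n + 1) := by
    calc ‖thuePade n‖ * 74 ≤ ‖thuePade n‖ * (4 * ‖19 + eisOmega‖) := by gcongr; linarith
      _ ≤ 3 ^ n * (2 * ‖-(2 * eisOmega + 1)‖ + 4 * ‖19 + eisOmega‖) ^ (n + 1) := h
      _ ≤ 3 ^ n * 77.55 ^ (n + 1) := by gcongr; linarith
  rw [pow_succ, ← mul_assoc, ← mul_pow] at h4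
  norm_num at h4 ⊢
  have := pow_pos (show (0 : ℝ) < 4653 / 20 by norm_num) n
  linarith

lemma abs_le_of_thuePade_eq {n : ℕ} {a b : ℤ}
    (h : thuePade n = padeGain n * (a + b * eisOmega)) :
    padeGain n * |((a - 3 * b : ℤ) : ℝ)| ≤ 3.21 * 232.65 ^ n := by
  have h1 : thuePade n * (2 - eisOmega) = (padeGain n : ℝ) *
      (((2 * a + b : ℤ) : ℝ) + ((-(a - 3 * b) : ℤ) : ℝ) * eisOmega) := by
    rw [h]
    push_cast
    linear_combination -(padeGain n * b : ℂ) * eisOmega_sq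
  have h2 := Complex.abs_im_le_norm (thuePade n * (2 - eisOmega))
  have h3 : √3 * √3 = 3 := Real.mul_self_sqrt (by norm_num)
  have h7 : ‖2 - eisOmega‖ ^ 2 = 7 := by
    rw [Complex.sq_norm, Complex.normSq_apply]
    simp [eisOmega]
    linarith
  have h7' : ‖2 - eisOmega‖ ≤ 2.6458 := by nlinarith [norm_nonneg (2 - eisOmega)]
  have hs : 1.732 ≤ √3 := Real.le_sqrt_of_sq_le (by norm_num)
  rw [norm_mul, h1, Complex.im_ofReal_mul, im_add_mul_eisOmega, abs_mul, abs_mul, Nat.abs_cast,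
    Int.cast_neg, abs_neg, abs_of_nonneg (show 0 ≤ √3 / 2 by positivity)] at h2
  have h4 : padeGain n * (|((a - 3 * b : ℤ) : ℝ)| * (1.732 / 2)) ≤
      1.05 * 232.65 ^ n * 2.6458 := by
    calc padeGain n * (|((a - 3 * b : ℤ) : ℝ)| * (1.732 / 2))
        ≤ padeGain n * (|((a - 3 * b : ℤ) : ℝ)| * (√3 / 2)) := by gcongr
      _ ≤ ‖thuePade n‖ * ‖2 - eisOmega‖ := h2
      _ ≤ 1.05 * 232.65 ^ n * 2.6458 := by
        gcongr
        exact norm_thuePade_le n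
  have := pow_pos (show (0 : ℝ) < 232.65 by norm_num) n
  linarith

/-- Good rational approximations `c / d` to `thueRoot`, from the approximant of index `n`. -/
lemma exists_close {m n : ℕ} (hm : 200 ≤ m) (hn : n = 4 * m ∨ n = 4 * m + 1) {a b : ℤ}
    (h : thuePade n = padeGain n * (a + b * eisOmega)) :
    |((2 * a + b : ℤ) : ℝ) - (a - 3 * b : ℤ) * thueRoot| * 27000 ^ m ≤ 1 / 8 ∧
      |((a - 3 * b : ℤ) : ℝ)| ≤ 800 * 490000000 ^ m := by
  have hD : (6 : ℝ) ^ m ≤ padeGain n := by exact_mod_cast six_pow_le_padeGain hm hn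
  have hpow : ∀ r : ℝ, 0 ≤ r → r ^ n ≤ max 1 r * (r ^ 4) ^ m := by
    intro r hr
    rcases hn with rfl | rfl
    · rw [pow_mul]
      exact le_mul_of_one_le_left (by positivity) (le_max_left _ _)
    · rw [pow_succ, pow_mul, mul_comm]
      gcongr
      exact le_max_right _ _
  have h6 : (0 : ℝ) < 6 ^ m := by positivity
  constructor
  · have h1 := thuePade_approx h
    have h2 := hpow 0.122 (by norm_num)
    have h3 : ((0.122 : ℝ) ^ 4) ^ m * 27000 ^ m ≤ 6 ^ m := by
      rw [← mul_pow]
      gcongr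
      norm_num
    rw [max_eq_left (by norm_num), one_mul] at h2
    set e := |((2 * a + b : ℤ) : ℝ) - (a - 3 * b : ℤ) * thueRoot|
    have he : 0 ≤ e := abs_nonneg _
    refine le_of_mul_le_mul_left ?_ h6
    calc 6 ^ m * (e * 27000 ^ m) = 6 ^ m * e * 27000 ^ m := by ring
      _ ≤ padeGain n * e * 27000 ^ m := by gcongr
      _ ≤ 0.122 ^ n * (2 - thueRoot) * 27000 ^ m := by gcongr
      _ ≤ (0.122 ^ 4) ^ m * (1 / 8) * 27000 ^ m := by
        gcongr
        · linarith [thueRoot_lt]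
        · linarith [thueRoot_gt]
      _ ≤ 6 ^ m * (1 / 8) := by linarith
  · have h1 := abs_le_of_thuePade_eq h
    have h2 := hpow 232.65 (by norm_num)
    rw [max_eq_right (by norm_num)] at h2
    have h3 : ((232.65 : ℝ) ^ 4) ^ m ≤ 6 ^ m * 490000000 ^ m := by
      rw [← mul_pow]
      gcongr
      norm_num
    refine le_of_mul_le_mul_left ?_ h6
    calc 6 ^ m * |((a - 3 * b : ℤ) : ℝ)| ≤ padeGain n * |((a - 3 * b : ℤ) : ℝ)| := by gcongr
      _ ≤ 3.21 * 232.65 ^ n := h1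
      _ ≤ 3.21 * (232.65 * (6 ^ m * 490000000 ^ m)) := by
        gcongr
        exact h2.trans (by gcongr)
      _ ≤ 6 ^ m * (800 * 490000000 ^ m) := by
        have : (0 : ℝ) < 6 ^ m * 490000000 ^ m := by positivity
        linarith

end ThueApproximants

lemma eq_two_one_of_pos {x y : ℤ} (hx : 0 < x) (hy : 0 < y) (h : |thueForm x y| = 1) :
    x = 2 ∧ y = 1 := by
  by_cases hsmall : y < 4 * 27000 ^ 200
  · exact eq_two_one_of_lt hx hy h hsmall
  exfalso
  have hex : ∃ k : ℕ, y < 4 * 27000 ^ k := by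
    obtain ⟨k, hk⟩ := pow_unbounded_of_one_lt y (show (1 : ℤ) < 27000 by norm_num)
    exact ⟨k, by linarith [pow_pos (show (0 : ℤ) < 27000 by norm_num) k]⟩
  obtain ⟨j, hj, hyj, hyj1⟩ : ∃ j : ℕ, 200 ≤ j ∧ (4 * 27000 ^ j : ℤ) ≤ y ∧
      y < 4 * 27000 ^ (j + 1) := by
    classical
    have hlt : 200 < Nat.find hex := by
      rw [Nat.lt_find_iff]
      intro i hi hlt
      exact hsmall (hlt.trans_le (by gcongr; norm_num))
    obtain ⟨j, hj⟩ := Nat.exists_eq_add_of_lt hlt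
    refine ⟨200 + j, by omega, not_lt.1 (Nat.find_min hex (by omega)), ?_⟩
    rw [← hj]
    exact Nat.find_spec hex
  have hxy := abs_sub_thueRoot_le hx hy h
  have hyR : (0 : ℝ) < y := by exact_mod_cast hy
  have hlow : (16 * 729000000 ^ j : ℝ) ≤ (y : ℝ) ^ 2 := by
    have h1 : (4 * 27000 ^ j : ℝ) ≤ y := by exact_mod_cast hyj
    calc (16 * 729000000 ^ j : ℝ) = (4 * 27000 ^ j) ^ 2 := by
          rw [mul_pow, ← pow_mul, mul_comm j, pow_mul]
          norm_num
      _ ≤ _ := by gcongr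
  have hup : (y : ℝ) < 4 * 27000 ^ (j + 1) := by exact_mod_cast hyj1
  have hgrow : (400 * 490000000 ^ (j + 1) : ℝ) ≤ 729000000 ^ j := by
    obtain ⟨i, rfl⟩ := Nat.exists_eq_add_of_le (show 100 ≤ j by omega)
    calc (400 * 490000000 ^ (100 + i + 1) : ℝ)
        = (400 * 490000000 ^ 101) * 490000000 ^ i := by ring
      _ ≤ 729000000 ^ 100 * 729000000 ^ i := by gcongr <;> norm_num
      _ = _ := by rw [pow_add]
  have key : ∀ n, n = 4 * (j + 1) ∨ n = 4 * (j + 1) + 1 → ∀ a b : ℤ,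
      thuePade n = padeGain n * (a + b * eisOmega) → (2 * a + b) * y = (a - 3 * b) * x := by
    intro n hn a b hab
    obtain ⟨h1, h2⟩ := exists_close (by omega) hn hab
    refine mul_eq_mul_of_close hy hxy ?_
    have h3 : y * |((2 * a + b : ℤ) : ℝ) - (a - 3 * b : ℤ) * thueRoot| ≤ 1 / 2 := by
      calc y * |((2 * a + b : ℤ) : ℝ) - (a - 3 * b : ℤ) * thueRoot|
          ≤ 4 * 27000 ^ (j + 1) * |((2 * a + b : ℤ) : ℝ) - (a - 3 * b : ℤ) * thueRoot| := by
            gcongr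
        _ ≤ 1 / 2 := by linarith
    have h4 : 2 * |((a - 3 * b : ℤ) : ℝ)| / (y : ℝ) ^ 2 < 1 / 2 := by
      rw [div_lt_iff₀ (by positivity)]
      have : (0 : ℝ) < 729000000 ^ j := by positivity
      linarith
    linarith
  obtain ⟨a, b, hab⟩ := exists_thuePade_eq (4 * (j + 1))
  obtain ⟨a', b', hab'⟩ := exists_thuePade_eq (4 * (j + 1) + 1)
  have h1 := key _ (Or.inl rfl) a b hab
  have h2 := key _ (Or.inr rfl) a' b' hab'
  apply thuePade_det_ne_zero hab hab'
  refine mul_left_cancel₀ (mul_pos (show (0 : ℤ) < 7 by norm_num) hy).ne' ?_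
  linear_combination (a' - 3 * b') * h1 - (a - 3 * b) * h2

lemma eq_two_one_of_thueForm_eq_one {x y : ℤ} (h : thueForm x y = 1) (hxy : 0 < x * y) :
    x = 2 ∧ y = 1 := by
  rcases pos_and_pos_or_neg_and_neg_of_mul_pos hxy with ⟨hx, hy⟩ | ⟨hx, hy⟩
  · exact eq_two_one_of_pos hx hy (by rw [h, abs_one])
  · have hneg : thueForm (-x) (-y) = -1 := by
      rw [← h]
      unfold thueForm
      ring
    obtain ⟨h1, h2⟩ := eq_two_one_of_pos (neg_pos.2 hx) (neg_pos.2 hy)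
      (by rw [hneg, abs_neg, abs_one])
    rw [h1, h2] at hneg
    norm_num [thueForm] at hneg

lemma eq_neg_one_of_thueForm_zero {y : ℤ} (h : thueForm 0 y = 1) : y = -1 := by
  have h1 : y ^ 3 = (-1) ^ 3 := by
    unfold thueForm at h
    linarith
  exact (Odd.strictMono_pow (by decide : Odd 3)).injective h1

lemma thueForm_rotate (x y : ℤ) : thueForm y (-x - y) = thueForm x y := by
  unfold thueForm
  ring

/-- Ljunggren's theorem: the integer solutions of the Thue equation m³ - 3mn² - n³ = 1
are exactly (1,0), (0,-1), (-1,1), (2,1), (1,-3), (-3,2). -/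
theorem ljunggren_thue (m n : ℤ) :
    m ^ 3 - 3 * m * n ^ 2 - n ^ 3 = 1 ↔
      (m, n) = (1, 0) ∨ (m, n) = (0, -1) ∨ (m, n) = (-1, 1) ∨
      (m, n) = (2, 1) ∨ (m, n) = (1, -3) ∨ (m, n) = (-3, 2) := by
  simp only [Prod.mk.injEq]
  constructor
  · intro h
    change thueForm m n = 1 at h
    obtain ⟨r, hr⟩ : ∃ r, r = -m - n := ⟨_, rfl⟩
    have hnr : thueForm n r = 1 := by rw [hr, thueForm_rotate, h]
    have hrm : thueForm r m = 1 := by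
      rw [show m = -n - r by omega, thueForm_rotate, hnr]
    by_cases hm0 : m = 0
    · have := eq_neg_one_of_thueForm_zero (hm0 ▸ h)
      omega
    by_cases hn0 : n = 0
    · have := eq_neg_one_of_thueForm_zero (hn0 ▸ hnr)
      omega
    by_cases hr0 : r = 0
    · have := eq_neg_one_of_thueForm_zero (hr0 ▸ hrm)
      omega
    have hsigns : 0 < m * n ∨ 0 < n * r ∨ 0 < r * m := by
      simp only [mul_pos_iff]
      omega
    rcases hsigns with hp | hp | hp
    · have := eq_two_one_of_thueForm_eq_one h hp
      omega
    · have := eq_two_one_of_thueForm_eq_one hnr hp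
      omega
    · have := eq_two_one_of_thueForm_eq_one hrm hp
      omega
  · rintro (⟨rfl, rfl⟩ | ⟨rfl, rfl⟩ | ⟨rfl, rfl⟩ | ⟨rfl, rfl⟩ | ⟨rfl, rfl⟩ | ⟨rfl, rfl⟩) <;> norm_num
end

section
/- Let f : ℚ → ℚ be given by f(x) = 3⁷(x²−1)³(x⁶+3x⁵+6x⁴+x³−3x²+12x+16)³(2x³+3x²−3x−5)/(x³−3x−1)⁹. If m, n are coprime integers with n ≠ 0 and f(m/n) is an integer (i.e. f(m/n) lies in the image of ℤ in ℚ), then m³ − 3mn² − n³ ∈ {1, −1, 3, −3}. -/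
/-- A prime dividing `m³ - 3mn² - n³` does not divide `n`. -/
theorem not_dvd_of_dvd_cubic {m n p : ℤ} (hmn : IsCoprime m n) (hp : Prime p)
    (hG : p ∣ m ^ 3 - 3 * m * n ^ 2 - n ^ 3) : ¬ p ∣ n := by
  intro hpn
  have hm : p ∣ m ^ 3 := by
    rw [show m ^ 3 = (m ^ 3 - 3 * m * n ^ 2 - n ^ 3) + n * (3 * m * n + n ^ 2) by ring]
    exact dvd_add hG (hpn.mul_right _)
  exact hp.not_isUnit (hmn.isUnit_of_dvd' (hp.dvd_of_dvd_pow hm) hpn)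

/-- The only prime that can divide both `m³ - 3mn² - n³` and the homogenized numerator of `f`
at coprime `m`, `n` is `3`. -/
theorem dvd_three_of_dvd_cubic_of_dvd_numerator {m n p : ℤ} (hmn : IsCoprime m n) (hp : Prime p)
    (hG : p ∣ m ^ 3 - 3 * m * n ^ 2 - n ^ 3)
    (hN : p ∣ 3 ^ 7 * (m ^ 2 - n ^ 2) ^ 3 *
      (m ^ 6 + 3 * m ^ 5 * n + 6 * m ^ 4 * n ^ 2 + m ^ 3 * n ^ 3 - 3 * m ^ 2 * n ^ 4 +
        12 * m * n ^ 5 + 16 * n ^ 6) ^ 3 *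
      (2 * m ^ 3 + 3 * m ^ 2 * n - 3 * m * n ^ 2 - 5 * n ^ 3)) : p ∣ 3 := by
  have hpn := not_dvd_of_dvd_cubic hmn hp hG
  have hpow (k : ℕ) : ¬ p ∣ n ^ k := fun h => hpn (hp.dvd_of_dvd_pow h)
  have hadd : ¬ p ∣ m + n := fun h => hpow 3 <| by
    rw [show n ^ 3 = (m ^ 3 - 3 * m * n ^ 2 - n ^ 3) - (m + n) * (m ^ 2 - m * n - 2 * n ^ 2) by
      ring]
    exact dvd_sub hG (h.mul_right _)
  rcases hp.dvd_or_dvd hN with hN | hC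
  · rcases hp.dvd_or_dvd hN with hN | hB
    · rcases hp.dvd_or_dvd hN with h3 | hA
      · exact hp.dvd_of_dvd_pow h3
      · have hA := hp.dvd_of_dvd_pow hA
        rw [show m ^ 2 - n ^ 2 = (m + n) * (m - n) by ring] at hA
        have hsub := (hp.dvd_or_dvd hA).resolve_left hadd
        have h : p ∣ 3 * n ^ 3 := by
          rw [show 3 * n ^ 3 = (m - n) * (m ^ 2 + m * n - 2 * n ^ 2) -
            (m ^ 3 - 3 * m * n ^ 2 - n ^ 3) by ring]
          exact dvd_sub (hsub.mul_right _) hG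
        exact (hp.dvd_or_dvd h).resolve_right (hpow 3)
    · have h : p ∣ 3 ^ 3 * n ^ 4 * (m + n) ^ 2 := by
        rw [show 3 ^ 3 * n ^ 4 * (m + n) ^ 2 =
          (m ^ 6 + 3 * m ^ 5 * n + 6 * m ^ 4 * n ^ 2 + m ^ 3 * n ^ 3 - 3 * m ^ 2 * n ^ 4 +
            12 * m * n ^ 5 + 16 * n ^ 6) - (m ^ 3 - 3 * m * n ^ 2 - n ^ 3) *
              (m ^ 3 + 3 * m ^ 2 * n + 9 * m * n ^ 2 + 11 * n ^ 3) by ring]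
        exact dvd_sub (hp.dvd_of_dvd_pow hB) (hG.mul_right _)
      have h := (hp.dvd_or_dvd h).resolve_right fun h => hadd (hp.dvd_of_dvd_pow h)
      exact hp.dvd_of_dvd_pow ((hp.dvd_or_dvd h).resolve_right (hpow 4))
  · have h : p ∣ 3 * n * (m ^ 2 + m * n - n ^ 2) := by
      rw [show 3 * n * (m ^ 2 + m * n - n ^ 2) =
        (2 * m ^ 3 + 3 * m ^ 2 * n - 3 * m * n ^ 2 - 5 * n ^ 3) -
          (m ^ 3 - 3 * m * n ^ 2 - n ^ 3) * 2 by ring]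
      exact dvd_sub hC (hG.mul_right _)
    rcases hp.dvd_or_dvd h with h | hQ
    · exact (hp.dvd_or_dvd h).resolve_right hpn
    · refine absurd ?_ (hpow 4)
      rw [show n ^ 4 = (m ^ 2 + m * n - n ^ 2) * (n ^ 2 - (m - n) ^ 2) +
        (m ^ 3 - 3 * m * n ^ 2 - n ^ 3) * (m - n) by ring]
      exact dvd_add (hQ.mul_right _) (hG.mul_right _)

/-- `m³ - 3mn² - n³` is not divisible by `9` when `m` and `n` are coprime. -/
theorem not_nine_dvd_cubic {m n : ℤ} (hmn : IsCoprime m n) :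
    ¬ 9 ∣ m ^ 3 - 3 * m * n ^ 2 - n ^ 3 := by
  intro h
  have hG : (3 : ℤ) ∣ m ^ 3 - 3 * m * n ^ 2 - n ^ 3 := dvd_trans (by norm_num) h
  refine not_dvd_of_dvd_cubic hmn Int.prime_three hG ?_
  have hsub : (3 : ℤ) ∣ (m - n) ^ 3 := by
    rw [show (m - n) ^ 3 = (m ^ 3 - 3 * m * n ^ 2 - n ^ 3) +
      3 * (2 * m * n ^ 2 - m ^ 2 * n) by ring]
    exact dvd_add hG (dvd_mul_right _ _)
  obtain ⟨k, hk⟩ := Int.prime_three.dvd_of_dvd_pow hsub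
  obtain rfl : m = n + 3 * k := by linarith
  obtain ⟨c, hc⟩ := h
  refine Int.prime_three.dvd_of_dvd_pow (n := 3) ⟨3 * k ^ 3 + 3 * n * k ^ 2 - c, ?_⟩
  linarith

/-- `m³ - 3mn² - n³` has no zero with `m`, `n` coprime. -/
theorem cubic_ne_zero_s17 {m n : ℤ} (hmn : IsCoprime m n) : m ^ 3 - 3 * m * n ^ 2 - n ^ 3 ≠ 0 :=
  fun h => not_nine_dvd_cubic hmn (h ▸ dvd_zero 9)

/-- If m, n are coprime integers with n ≠ 0 and f(m/n) is an integer, then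
m³ - 3mn² - n³ ∈ {1, -1, 3, -3}. -/
theorem integrality_constraint (m n : ℤ) (hmn : IsCoprime m n) (hn : n ≠ 0)
    (h : ∃ k : ℤ, f ((m : ℚ) / (n : ℚ)) = (k : ℚ)) :
    m ^ 3 - 3 * m * n ^ 2 - n ^ 3 = 1 ∨ m ^ 3 - 3 * m * n ^ 2 - n ^ 3 = -1 ∨
    m ^ 3 - 3 * m * n ^ 2 - n ^ 3 = 3 ∨ m ^ 3 - 3 * m * n ^ 2 - n ^ 3 = -3 := by
  obtain ⟨k, hk⟩ := h
  have hG0 := cubic_ne_zero_s17 hmn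
  have hN : 3 ^ 7 * (m ^ 2 - n ^ 2) ^ 3 *
      (m ^ 6 + 3 * m ^ 5 * n + 6 * m ^ 4 * n ^ 2 + m ^ 3 * n ^ 3 - 3 * m ^ 2 * n ^ 4 +
        12 * m * n ^ 5 + 16 * n ^ 6) ^ 3 *
      (2 * m ^ 3 + 3 * m ^ 2 * n - 3 * m * n ^ 2 - 5 * n ^ 3) =
      (m ^ 3 - 3 * m * n ^ 2 - n ^ 3) ^ 9 * k := by
    have hnQ : (n : ℚ) ≠ 0 := by exact_mod_cast hn
    have hGQ : (m : ℚ) ^ 3 - 3 * m * n ^ 2 - n ^ 3 ≠ 0 := by exact_mod_cast hG0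
    obtain ⟨x, hx⟩ : ∃ x : ℚ, x = m / n := ⟨_, rfl⟩
    have hm : (m : ℚ) = x * n := by rw [hx, div_mul_cancel₀ _ hnQ]
    have hden : x ^ 3 - 3 * x - 1 ≠ 0 := by
      intro h0
      apply hGQ
      rw [hm]
      linear_combination (n : ℚ) ^ 3 * h0
    rw [← hx, f, div_eq_iff (pow_ne_zero 9 hden)] at hk
    have hscale := congrArg (· * (n : ℚ) ^ 27) hk
    qify
    rw [hm]
    calc
      _ = 3 ^ 7 * (x ^ 2 - 1) ^ 3 *
          (x ^ 6 + 3 * x ^ 5 + 6 * x ^ 4 + x ^ 3 - 3 * x ^ 2 + 12 * x + 16) ^ 3 *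
          (2 * x ^ 3 + 3 * x ^ 2 - 3 * x - 5) * (n : ℚ) ^ 27 := by ring
      _ = k * (x ^ 3 - 3 * x - 1) ^ 9 * (n : ℚ) ^ 27 := hscale
      _ = _ := by ring
  have hprime : ∀ {p : ℕ}, p.Prime → p ∣ (m ^ 3 - 3 * m * n ^ 2 - n ^ 3).natAbs → p = 3 := by
    intro p hp hpG
    have hpG : (p : ℤ) ∣ m ^ 3 - 3 * m * n ^ 2 - n ^ 3 := Int.natCast_dvd.mpr hpG
    have h3 := dvd_three_of_dvd_cubic_of_dvd_numerator hmn (Nat.prime_iff_prime_int.mp hp) hpG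
      (hN ▸ (dvd_pow hpG (by norm_num)).mul_right k)
    exact (Nat.prime_dvd_prime_iff_eq hp Nat.prime_three).mp (by exact_mod_cast h3)
  have hpow := Nat.eq_prime_pow_of_unique_prime_dvd (Int.natAbs_ne_zero.mpr hG0) hprime
  have h9 : ¬ 3 ^ 2 ∣ (m ^ 3 - 3 * m * n ^ 2 - n ^ 3).natAbs := fun h =>
    not_nine_dvd_cubic hmn (Int.natCast_dvd.mpr h)
  generalize (m ^ 3 - 3 * m * n ^ 2 - n ^ 3).natAbs.primeFactorsList.length = e at hpow
  have he : e < 2 := by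
    by_contra! he
    exact h9 (hpow ▸ pow_dvd_pow 3 he)
  interval_cases e <;> omega
end
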